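/- arXiv:2201.08000 — 7 statements merged into one kernel-verified Lean document; each statement's English description precedes it below -/
import Mathlib

section
/- Let F : 𝒜 → 𝒝 and H : 𝒝 → 𝒜 be an adjoint pair (F, H) of exact functors between abelian categories with enough projective objects such that H sends projective objects to projective objects. Then F sends projective objects to projective objects and Gorenstein projective objects to Gorenstein projective objects. -/
open CategoryTheory CategoryTheory.Limits

section GorensteinPrelude

variable {C : Type*} [Category C] [Abelian C]

/-- A totally acyclic complex of projective objects, encoded by its objects `P n` and
differentials `d n : P n ⟶ P (n + 1)`: each `P n` is projective, consecutive differentials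
compose to zero, the complex is acyclic (exact at each spot), and it stays exact after
applying `Hom(-, Q)` for every projective object `Q`. -/
structure IsTotallyAcyclic (P : ℤ → C) (d : ∀ n : ℤ, P n ⟶ P (n + 1)) : Prop where
  projective : ∀ n, Projective (P n)
  comp_eq_zero : ∀ n, d n ≫ d (n + 1) = 0
  exact : ∀ n, (ShortComplex.mk (d n) (d (n + 1)) (comp_eq_zero n)).Exact
  hom_exact : ∀ (Q : C), Projective Q → ∀ n,
    Function.Exact (fun g : P (n + 1 + 1) ⟶ Q => d (n + 1) ≫ g)
      (fun g : P (n + 1) ⟶ Q => d n ≫ g)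

/-- An object is Gorenstein projective if it is isomorphic to a cycle object of some
totally acyclic complex of projective objects. -/
def IsGorensteinProjective (M : C) : Prop :=
  ∃ (P : ℤ → C) (d : ∀ n : ℤ, P n ⟶ P (n + 1)) (_ : IsTotallyAcyclic P d) (n : ℤ),
    Nonempty (M ≅ kernel (d n))

/-- `pdLE n X` : `X` admits a projective resolution of length at most `n`,
i.e. an exact sequence `0 → P_n → ⋯ → P_0 → X → 0` with every `P_i` projective. -/
def pdLE : ℕ → C → Prop
  | 0, X => Projective X
  | (n + 1), X => ∃ (K P : C) (i : K ⟶ P) (p : P ⟶ X) (w : i ≫ p = 0),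
      Projective P ∧ (ShortComplex.mk i p w).ShortExact ∧ pdLE n K

/-- `X` has finite projective dimension. -/
def HasFinitePd (X : C) : Prop := ∃ n, pdLE n X

/-- `gpdLE n X` : `X` admits a Gorenstein projective resolution of length at most `n`,
i.e. an exact sequence `0 → G_n → ⋯ → G_0 → X → 0` with every `G_i` Gorenstein projective. -/
def gpdLE : ℕ → C → Prop
  | 0, X => IsGorensteinProjective X
  | (n + 1), X => ∃ (K G : C) (i : K ⟶ G) (p : G ⟶ X) (w : i ≫ p = 0),
      IsGorensteinProjective G ∧ (ShortComplex.mk i p w).ShortExact ∧ gpdLE n K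

/-- `X` has finite Gorenstein projective dimension. -/
def HasFiniteGpd (X : C) : Prop := ∃ n, gpdLE n X

/-- A morphism factors through a projective object. -/
def FactorsThroughProjective {X Y : C} (f : X ⟶ Y) : Prop :=
  ∃ (P : C) (_ : Projective P) (a : X ⟶ P) (b : P ⟶ Y), f = a ≫ b

/-- Two parallel morphisms become equal in the stable category, i.e. their difference
factors through a projective object. -/
def StablyEqual {X Y : C} (f g : X ⟶ Y) : Prop := FactorsThroughProjective (f - g)

/-- A morphism is a stable isomorphism if it becomes invertible in the stable category
(morphisms modulo those factoring through a projective object). -/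
def IsStableIso {X Y : C} (f : X ⟶ Y) : Prop :=
  ∃ g : Y ⟶ X, StablyEqual (f ≫ g) (𝟙 X) ∧ StablyEqual (g ≫ f) (𝟙 Y)

end GorensteinPrelude

namespace IsTotallyAcyclic

variable {A : Type*} [Category A] [Abelian A] {B : Type*} [Category B] [Abelian B]

/-- An exact functor whose right adjoint preserves projective objects and which itself preserves
projective objects sends totally acyclic complexes to totally acyclic complexes. -/
theorem map_of_adjunction {P : ℤ → A} {d : ∀ n : ℤ, P n ⟶ P (n + 1)}
    (hP : IsTotallyAcyclic P d) {F : A ⥤ B} {H : B ⥤ A} [F.Additive]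
    [PreservesFiniteLimits F] [PreservesFiniteColimits F] (adj : F ⊣ H)
    (hF : ∀ X : A, Projective X → Projective (F.obj X))
    (hH : ∀ Y : B, Projective Y → Projective (H.obj Y)) :
    IsTotallyAcyclic (fun n => F.obj (P n)) (fun n => F.map (d n)) where
  projective n := hF _ (hP.projective n)
  comp_eq_zero n := by rw [← F.map_comp, hP.comp_eq_zero, F.map_zero]
  exact n := (hP.exact n).map F
  hom_exact Q hQ n g := by
    have h := hP.hom_exact (H.obj Q) (hH Q hQ) n (adj.homEquiv _ _ g)
    constructor
    · intro hg
      obtain ⟨k, hk⟩ := h.1 (by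
        have := congrArg (adj.homEquiv _ _) hg
        have h0 : adj.homEquiv _ _ (0 : F.obj (P n) ⟶ Q) = 0 := by
          have := adj.right_adjoint_additive
          simp [Adjunction.homEquiv_unit]
        simpa [Adjunction.homEquiv_naturality_left, h0] using this)
      refine ⟨(adj.homEquiv _ _).symm k, (adj.homEquiv _ _).injective ?_⟩
      simpa [Adjunction.homEquiv_naturality_left] using hk
    · rintro ⟨k, rfl⟩
      simp [← F.map_comp_assoc, hP.comp_eq_zero]

end IsTotallyAcyclic

/-- Corollary 3.2 of the paper. Let `(F, H)` be an adjoint pair of exact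
functors between abelian categories with enough projective objects such that `H` preserves
projective objects. Then `F` preserves projective objects and Gorenstein projective objects. -/
theorem left_adjoint_preserves_gorenstein_projective
    {A : Type*} [Category A] [Abelian A] [EnoughProjectives A]
    {B : Type*} [Category B] [Abelian B] [EnoughProjectives B]
    (F : A ⥤ B) (H : B ⥤ A) [F.Additive] [H.Additive]
    [PreservesFiniteLimits F] [PreservesFiniteColimits F]
    [PreservesFiniteLimits H] [PreservesFiniteColimits H]
    (adj : F ⊣ H)
    (hH : ∀ Y : B, Projective Y → Projective (H.obj Y)) :
    (∀ X : A, Projective X → Projective (F.obj X)) ∧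
      (∀ X : A, IsGorensteinProjective X → IsGorensteinProjective (F.obj X)) := by
  have hF : ∀ X : A, Projective X → Projective (F.obj X) :=
    fun X hX => adj.map_projective X hX
  refine ⟨hF, ?_⟩
  rintro X ⟨P, d, hP, n, ⟨e⟩⟩
  exact ⟨_, _, hP.map_of_adjunction adj hF hH, n,
    ⟨F.mapIso e ≪≫ PreservesKernel.iso F (d n)⟩⟩
end

section
/- Let 𝒜 be an abelian category with enough projective objects and let X and Y be Gorenstein projective objects of 𝒜. Then X and Y are isomorphic in the stable category of Gorenstein projective objects if and only if there exist projective objects P and Q of 𝒜 and an isomorphism X ⊕ P ≅ Y ⊕ Q in 𝒜. -/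
open CategoryTheory CategoryTheory.Limits

section FactorsThroughProjective

variable {C : Type*} [Category C]

lemma FactorsThroughProjective.comp_comp {W X Y Z : C} {f : X ⟶ Y}
    (hf : FactorsThroughProjective f) (u : W ⟶ X) (v : Y ⟶ Z) :
    FactorsThroughProjective (u ≫ f ≫ v) := by
  obtain ⟨P, hP, a, b, rfl⟩ := hf
  exact ⟨P, hP, u ≫ a, b ≫ v, by simp⟩

/-- An object whose identity factors through a projective object is projective. -/
lemma FactorsThroughProjective.projective {X : C} (h : FactorsThroughProjective (𝟙 X)) :
    Projective X := by
  obtain ⟨P, hP, a, b, hab⟩ := h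
  exact (Retract.mk a b hab.symm).projective

variable [Abelian C]

lemma FactorsThroughProjective.add {X Y : C} {f g : X ⟶ Y} (hf : FactorsThroughProjective f)
    (hg : FactorsThroughProjective g) : FactorsThroughProjective (f + g) := by
  obtain ⟨P, hP, a, b, rfl⟩ := hf
  obtain ⟨Q, hQ, c, d, rfl⟩ := hg
  exact ⟨P ⊞ Q, inferInstance, biprod.lift a c, biprod.desc b d, by simp⟩

lemma FactorsThroughProjective.neg {X Y : C} {f : X ⟶ Y} (hf : FactorsThroughProjective f) :
    FactorsThroughProjective (-f) := by
  obtain ⟨P, hP, a, b, rfl⟩ := hf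
  exact ⟨P, hP, -a, b, by simp⟩

/-- A split epimorphism that is a stable isomorphism has projective kernel, and splits off
this kernel. -/
lemma exists_projective_biprod_iso_of_retract {X Z : C} (s : X ⟶ Z) (r : Z ⟶ X)
    (hsr : s ≫ r = 𝟙 X) (h : FactorsThroughProjective (𝟙 Z - r ≫ s)) :
    ∃ K : C, Projective K ∧ Nonempty ((X ⊞ K) ≅ Z) := by
  have : IsSplitEpi r := ⟨⟨⟨s, hsr⟩⟩⟩
  let S := ShortComplex.mk (kernel.ι r) r (kernel.condition r)
  have hS : S.Exact := ShortComplex.exact_kernel r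
  let σ : S.Splitting := ShortComplex.Splitting.ofExactOfSection S hS s hsr inferInstance
  refine ⟨kernel r, FactorsThroughProjective.projective ?_,
    ⟨biprod.braiding _ _ ≪≫ σ.isoBinaryBiproduct.symm⟩⟩
  have hid : 𝟙 (kernel r) = kernel.ι r ≫ (𝟙 Z - r ≫ s) ≫ σ.r := by
    have : kernel.ι r ≫ σ.r = 𝟙 (kernel r) := σ.f_r
    simp [Preadditive.sub_comp, this]
  rw [hid]
  exact h.comp_comp _ _

/-- The corner of an isomorphism `X ⊞ P ≅ Y ⊞ Q` with `Q` projective is stably inverse to the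
corner of its inverse, on the side of `X`. -/
lemma stablyEqual_corner_comp_corner {X Y P Q : C} (hQ : Projective Q)
    (e : (X ⊞ P) ≅ (Y ⊞ Q)) :
    StablyEqual ((biprod.inl ≫ e.hom ≫ biprod.fst) ≫ biprod.inl ≫ e.inv ≫ biprod.fst) (𝟙 X) := by
  refine ⟨Q, hQ, -(biprod.inl ≫ e.hom ≫ biprod.snd), biprod.inr ≫ e.inv ≫ biprod.fst, ?_⟩
  have h : (biprod.inl ≫ e.hom) ≫ (biprod.fst ≫ biprod.inl + biprod.snd ≫ biprod.inr) ≫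
      e.inv ≫ biprod.fst = 𝟙 X := by
    rw [biprod.total]; simp
  simp only [Preadditive.add_comp, Preadditive.comp_add, Category.assoc] at h
  simp only [Preadditive.neg_comp, Category.assoc]
  rw [← h]
  abel

end FactorsThroughProjective

/-- Lemma 4.1 of the paper. Two Gorenstein projective objects `X` and `Y`
of an abelian category with enough projectives are isomorphic in the stable category of
Gorenstein projective objects if and only if `X ⊕ P ≅ Y ⊕ Q` in the ambient category for
some projective objects `P` and `Q`. -/
theorem stably_iso_iff_biprod_iso
    {C : Type*} [Category C] [Abelian C] [EnoughProjectives C]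
    (X Y : C) (hX : IsGorensteinProjective X) (hY : IsGorensteinProjective Y) :
    (∃ f : X ⟶ Y, IsStableIso f) ↔
      ∃ (P Q : C), Projective P ∧ Projective Q ∧ Nonempty ((X ⊞ P) ≅ (Y ⊞ Q)) := by
  constructor
  · rintro ⟨f, g, ⟨P, hP, a, b, hab⟩, hgf⟩
    obtain ⟨K, hK, ⟨e⟩⟩ := exists_projective_biprod_iso_of_retract
      (biprod.lift f (-a)) (biprod.desc g b)
      (by rw [biprod.lift_desc, Preadditive.neg_comp, ← hab]; abel)
      (by
        have h₁ := (FactorsThroughProjective.neg hgf).comp_comp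
          (biprod.fst : Y ⊞ P ⟶ Y) (biprod.inl : Y ⟶ Y ⊞ P)
        have h₂ : FactorsThroughProjective
            ((biprod.snd : Y ⊞ P ⟶ P) ≫ (biprod.inr - b ≫ biprod.lift f (-a))) :=
          ⟨P, hP, _, _, rfl⟩
        have h₃ : FactorsThroughProjective
            (((biprod.fst : Y ⊞ P ⟶ Y) ≫ g ≫ a) ≫ (biprod.inr : P ⟶ Y ⊞ P)) :=
          ⟨P, hP, _, _, rfl⟩
        convert (h₁.add h₂).add h₃ using 1
        ext <;> simp)
    exact ⟨K, P, hK, hP, ⟨e⟩⟩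
  · rintro ⟨P, Q, hP, hQ, ⟨e⟩⟩
    exact ⟨biprod.inl ≫ e.hom ≫ biprod.fst, biprod.inl ≫ e.inv ≫ biprod.fst,
      stablyEqual_corner_comp_corner hQ e, stablyEqual_corner_comp_corner hP e.symm⟩
end

section
/- Let 𝒜 be an abelian category with enough projective objects, let X, Y, Z be Gorenstein projective objects, let f : X → Y be a monomorphism whose cokernel is Gorenstein projective, and let g : X → Z be any morphism. Then the pushout Y ⊔_X Z of f and g, computed in 𝒜, is Gorenstein projective, and the canonical morphism Z → Y ⊔_X Z is a monomorphism whose cokernel is isomorphic to the cokernel of f. -/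
open CategoryTheory CategoryTheory.Limits

section GorensteinExtensions

variable {C : Type*} [Category C]

/-- A relation which is total in both directions admits bi-infinite chains through any element. -/
theorem exists_int_chain {α : Type*} (r : α → α → Prop) (hr : ∀ a, ∃ b, r a b)
    (hl : ∀ b, ∃ a, r a b) (x : α) :
    ∃ s : ℤ → α, s 0 = x ∧ ∀ n, r (s n) (s (n + 1)) := by
  choose next hnext using hr
  choose prev hprev using hl
  let up : ℕ → α := fun k => Nat.rec x (fun _ a => next a) k
  let down : ℕ → α := fun k => Nat.rec (prev x) (fun _ a => prev a) k
  refine ⟨fun n => match n with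
    | Int.ofNat k => up k
    | Int.negSucc k => down k, rfl, ?_⟩
  rintro (k | _ | k)
  · exact hnext (up k)
  · exact hprev x
  · exact hprev (down k)

variable [Abelian C]

/-- Every morphism from the left end of a short exact sequence ending in `M` to a projective
object extends to the middle term, i.e. `Ext¹(M, Q) = 0` for every projective object `Q`. -/
def ExtendsToProjectives (M : C) : Prop :=
  ∀ (U V : C) (u : U ⟶ V) (v : V ⟶ M) (w : u ≫ v = 0), (ShortComplex.mk u v w).ShortExact →
    ∀ (Q : C), Projective Q → ∀ φ : U ⟶ Q, ∃ ψ : V ⟶ Q, u ≫ ψ = φ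

/-- There is a short exact sequence `0 → M → P → N → 0` with `P` projective. -/
def IsSyzygy (M N : C) : Prop :=
  ∃ (P : C) (i : M ⟶ P) (p : P ⟶ N) (w : i ≫ p = 0),
    Projective P ∧ (ShortComplex.mk i p w).ShortExact

theorem IsSyzygy.of_iso {M N M' N' : C} (h : IsSyzygy M N) (e : M ≅ M') (e' : N ≅ N') :
    IsSyzygy M' N' := by
  obtain ⟨P, i, p, w, hP, hS⟩ := h
  refine ⟨P, e.inv ≫ i, p ≫ e'.hom, by simp [reassoc_of% w], hP, ?_⟩
  refine ShortComplex.shortExact_of_iso (S₁ := ShortComplex.mk i p w)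
    (ShortComplex.isoMk e (Iso.refl _) e' ?_ ?_) hS <;> simp

/-- To show that morphisms into projectives extend, one presentation by a projective suffices. -/
theorem ExtendsToProjectives.of_presentation {K P M : C} [Projective P] (i : K ⟶ P) (p : P ⟶ M)
    (w : i ≫ p = 0) (hS : (ShortComplex.mk i p w).ShortExact)
    (h : ∀ (Q : C), Projective Q → ∀ φ : K ⟶ Q, ∃ ψ : P ⟶ Q, i ≫ ψ = φ) :
    ExtendsToProjectives M := by
  intro U V u v w' hS' Q hQ φ
  have := hS.epi_g
  have := hS.mono_f
  have := hS'.epi_g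
  have := hS'.mono_f
  dsimp at *
  obtain ⟨l, hl⟩ : ∃ l : P ⟶ V, l ≫ v = p := ⟨Projective.factorThru p v, by simp⟩
  obtain ⟨k, hk⟩ := hS'.exact.lift' (i ≫ l) (by simp [hl, w])
  dsimp at k hk
  obtain ⟨ψ, hψ⟩ := h Q hQ (k ≫ φ)
  have : Epi (biprod.desc l u) := by
    refine Preadditive.epi_of_cancel_zero _ fun x hx => ?_
    have h₁ : l ≫ x = 0 := by simpa using biprod.inl ≫= hx
    have h₂ : u ≫ x = 0 := by simpa using biprod.inr ≫= hx
    obtain ⟨y, hy⟩ := hS'.exact.desc' x h₂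
    dsimp at y hy
    have hy' : p ≫ y = 0 := by rw [← hl, Category.assoc, hy, h₁]
    rw [← hy, (cancel_epi p).1 (hy'.trans comp_zero.symm), comp_zero]
  have key {T : C} (t : T ⟶ P ⊞ U) (ht : t ≫ biprod.desc l u = 0) :
      t ≫ biprod.desc ψ φ = 0 := by
    rw [biprod.desc_eq, Preadditive.comp_add] at ht
    have ht₁ : (t ≫ biprod.fst) ≫ p = 0 := by
      have := ht =≫ v
      simpa [hl, w'] using this
    obtain ⟨s, hs⟩ := hS.exact.lift' (t ≫ biprod.fst) ht₁
    dsimp at s hs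
    have hsk : s ≫ k + t ≫ biprod.snd = 0 := by
      rw [← cancel_mono u]
      simpa [hk, ← reassoc_of% hs] using ht
    have := hsk =≫ φ
    rw [biprod.desc_eq, Preadditive.comp_add, ← Category.assoc, ← hs, Category.assoc, hψ]
    simpa using this
  have hker := key _ (kernel.condition (biprod.desc l u))
  refine ⟨Abelian.epiDesc (biprod.desc l u) (biprod.desc ψ φ) hker, ?_⟩
  have := biprod.inr ≫= Abelian.comp_epiDesc (biprod.desc l u) (biprod.desc ψ φ) hker
  rwa [biprod.inr_desc_assoc, biprod.inr_desc] at this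

theorem ExtendsToProjectives.of_extension {A B D : C} (a : A ⟶ B) (b : B ⟶ D) (w : a ≫ b = 0)
    (hS : (ShortComplex.mk a b w).ShortExact) (hA : ExtendsToProjectives A)
    (hD : ExtendsToProjectives D) : ExtendsToProjectives B := by
  intro U V u v w' hS' Q hQ φ
  have := hS.epi_g
  have := hS.mono_f
  have := hS'.epi_g
  have := hS'.mono_f
  dsimp at *
  let u' : U ⟶ pullback v a := pullback.lift u 0 (by simp [w'])
  have hu' : u' ≫ pullback.fst v a = u := pullback.lift_fst _ _ _
  have hu'' : u' ≫ pullback.snd v a = 0 := pullback.lift_snd _ _ _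
  have : Mono u' := mono_of_mono_fac hu'
  obtain ⟨ψ, hψ⟩ := hA U _ u' (pullback.snd v a) hu''
    (ShortComplex.ShortExact.mk' (by
      rw [ShortComplex.exact_iff_exact_up_to_refinements]
      intro T x hx
      dsimp at x hx
      obtain ⟨s, hs⟩ := hS'.exact.lift' (x ≫ pullback.fst v a)
        (by dsimp; rw [Category.assoc, pullback.condition, reassoc_of% hx, zero_comp])
      exact ⟨T, 𝟙 T, inferInstance, s, by
        apply pullback.hom_ext
        · simpa [hu'] using hs.symm
        · simpa [hu''] using hx⟩) ‹_› (by dsimp; infer_instance)) Q hQ φ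
  obtain ⟨χ, hχ⟩ := hD _ V (pullback.fst v a) (v ≫ b) (by simp [pullback.condition_assoc, w])
    (ShortComplex.ShortExact.mk' (by
      rw [ShortComplex.exact_iff_exact_up_to_refinements]
      intro T x hx
      dsimp at x hx
      obtain ⟨s, hs⟩ := hS.exact.lift' (x ≫ v) (by simpa using hx)
      exact ⟨T, 𝟙 T, inferInstance, pullback.lift x s hs.symm,
        (Category.id_comp _).trans (pullback.lift_fst _ _ _).symm⟩)
      (by dsimp; infer_instance) (by dsimp; infer_instance)) Q hQ ψ
  exact ⟨χ, by rw [← hu', Category.assoc, hχ, hψ]⟩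

/-- A class of objects closed under taking syzygies and cosyzygies, and consisting of objects
without extensions by projectives, consists of Gorenstein projective objects. -/
theorem isGorensteinProjective_of_closed (K : C → Prop)
    (hE : ∀ M, K M → ExtendsToProjectives M) (hr : ∀ M, K M → ∃ N, K N ∧ IsSyzygy M N)
    (hl : ∀ N, K N → ∃ M, K M ∧ IsSyzygy M N) {X : C} (hX : K X) :
    IsGorensteinProjective X := by
  obtain ⟨s, h0, hs⟩ := exists_int_chain (α := {M : C // K M}) (fun M N => IsSyzygy M.1 N.1)
    (fun M => let ⟨N, hN, h⟩ := hr M.1 M.2; ⟨⟨N, hN⟩, h⟩)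
    (fun N => let ⟨M, hM, h⟩ := hl N.1 N.2; ⟨⟨M, hM⟩, h⟩) ⟨X, hX⟩
  choose P i p w hP hS using hs
  have hepi : ∀ n, Epi (p n) := fun n => (hS n).epi_g
  have hmono : ∀ n, Mono (i n) := fun n => (hS n).mono_f
  have hz : ∀ n, (p n ≫ i (n + 1)) ≫ p (n + 1) ≫ i (n + 1 + 1) = 0 := fun n => by
    simp [reassoc_of% (w (n + 1))]
  refine ⟨P, fun n => p n ≫ i (n + 1), ⟨hP, hz, ?_, ?_⟩, 0, ⟨?_⟩⟩
  · intro n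
    let T := ShortComplex.mk (i (n + 1)) (p (n + 1) ≫ i (n + 1 + 1))
      (by simp [reassoc_of% (w (n + 1))])
    let φ : ShortComplex.mk _ _ (hz n) ⟶ T :=
      { τ₁ := p n, τ₂ := 𝟙 _, τ₃ := 𝟙 _ }
    let ψ : ShortComplex.mk _ _ (w (n + 1)) ⟶ T :=
      { τ₁ := 𝟙 _, τ₂ := 𝟙 _, τ₃ := i (n + 1 + 1) }
    have : Epi φ.τ₁ := hepi n
    have : IsIso φ.τ₂ := by dsimp [φ]; infer_instance
    have : Mono φ.τ₃ := by dsimp [φ]; infer_instance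
    have : Epi ψ.τ₁ := by dsimp [ψ]; infer_instance
    have : IsIso ψ.τ₂ := by dsimp [ψ]; infer_instance
    have : Mono ψ.τ₃ := hmono _
    exact (ShortComplex.exact_iff_of_epi_of_isIso_of_mono φ).2
      ((ShortComplex.exact_iff_of_epi_of_isIso_of_mono ψ).1 (hS (n + 1)).exact)
  · intro Q hQ n g
    constructor
    · intro hg
      dsimp at hg
      have hg' : i (n + 1) ≫ g = 0 := by
        rw [← cancel_epi (p n)]
        simpa using hg
      obtain ⟨g', h₁⟩ := (hS (n + 1)).exact.desc' g hg'
      obtain ⟨h, h₂⟩ := hE _ (s (n + 1 + 1 + 1)).2 _ _ _ _ _ (hS (n + 1 + 1)) Q hQ g'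
      dsimp at h₁
      exact ⟨h, by simp [h₂, h₁]⟩
    · rintro ⟨h, rfl⟩
      simpa using hz n =≫ h
  · have e : (s 0).1 ≅ kernel (p 0) :=
      (hS 0).fIsKernel.conePointUniqueUpToIso (limit.isLimit _)
    exact eqToIso (by rw [h0]) ≪≫ e ≪≫ (kernelCompMono (p 0) (i (0 + 1))).symm

section TotallyAcyclic

variable {P : ℤ → C} {d : ∀ n : ℤ, P n ⟶ P (n + 1)}

theorem IsTotallyAcyclic.shortExact (h : IsTotallyAcyclic P d) (n : ℤ) :
    (ShortComplex.mk (kernel.ι (d n)) (kernel.lift (d (n + 1)) (d n) (h.comp_eq_zero n))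
      (by rw [← cancel_mono (kernel.ι _)]; simp)).ShortExact := by
  have : Epi (kernel.lift (d (n + 1)) (d n) (h.comp_eq_zero n)) :=
    (ShortComplex.exact_iff_epi_kernel_lift _).1 (h.exact n)
  refine ShortComplex.ShortExact.mk' ?_ (by dsimp; infer_instance) this
  rw [ShortComplex.exact_iff_exact_up_to_refinements]
  intro T x hx
  dsimp at x hx
  exact ⟨T, 𝟙 T, inferInstance, kernel.lift _ x
    (by simpa using hx =≫ kernel.ι (d (n + 1))), by simp⟩

theorem IsTotallyAcyclic.isSyzygy (h : IsTotallyAcyclic P d) (n : ℤ) :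
    IsSyzygy (kernel (d n)) (kernel (d (n + 1))) :=
  ⟨_, _, _, _, h.projective n, h.shortExact n⟩

theorem IsTotallyAcyclic.extendsToProjectives (h : IsTotallyAcyclic P d) (n : ℤ) :
    ExtendsToProjectives (kernel (d n)) := by
  obtain ⟨m, rfl⟩ : ∃ m, n = m + 1 + 1 + 1 := ⟨n - 3, by ring⟩
  have := h.projective (m + 1 + 1)
  refine .of_presentation _ _ _ (h.shortExact (m + 1 + 1)) fun Q hQ φ => ?_
  have := (h.shortExact (m + 1)).epi_g
  dsimp at this
  obtain ⟨ψ, hψ⟩ := (h.hom_exact Q hQ m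
    (kernel.lift (d (m + 1 + 1)) (d (m + 1)) (h.comp_eq_zero _) ≫ φ)).1 (by
      have : d m ≫ kernel.lift (d (m + 1 + 1)) (d (m + 1)) (h.comp_eq_zero _) = 0 := by
        rw [← cancel_mono (kernel.ι _)]
        simp [h.comp_eq_zero]
      simp [reassoc_of% this])
  refine ⟨ψ, ?_⟩
  rw [← cancel_epi (kernel.lift (d (m + 1 + 1)) (d (m + 1)) (h.comp_eq_zero _))]
  simpa using hψ

end TotallyAcyclic

namespace IsGorensteinProjective

theorem of_iso {M N : C} (h : IsGorensteinProjective M) (e : M ≅ N) :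
    IsGorensteinProjective N := by
  obtain ⟨P, d, hP, n, ⟨e'⟩⟩ := h
  exact ⟨P, d, hP, n, ⟨e.symm ≪≫ e'⟩⟩

theorem extendsToProjectives {M : C} (h : IsGorensteinProjective M) :
    ExtendsToProjectives M := by
  obtain ⟨P, d, hP, n, ⟨e⟩⟩ := h
  intro U V u v w hS
  exact hP.extendsToProjectives n U V u (v ≫ e.hom) (by simp [reassoc_of% w])
    (ShortComplex.shortExact_of_iso (S₁ := ShortComplex.mk u v w)
      (ShortComplex.isoMk (Iso.refl _) (Iso.refl _) e (by simp) (by simp)) hS)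

theorem exists_isSyzygy_right {M : C} (h : IsGorensteinProjective M) :
    ∃ N, IsGorensteinProjective N ∧ IsSyzygy M N := by
  obtain ⟨P, d, hP, n, ⟨e⟩⟩ := h
  exact ⟨_, ⟨P, d, hP, n + 1, ⟨Iso.refl _⟩⟩, (hP.isSyzygy n).of_iso e.symm (Iso.refl _)⟩

theorem exists_isSyzygy_left {N : C} (h : IsGorensteinProjective N) :
    ∃ M, IsGorensteinProjective M ∧ IsSyzygy M N := by
  obtain ⟨P, d, hP, n, ⟨e⟩⟩ := h
  obtain ⟨m, rfl⟩ : ∃ m, n = m + 1 := ⟨n - 1, by ring⟩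
  exact ⟨_, ⟨P, d, hP, m, ⟨Iso.refl _⟩⟩, (hP.isSyzygy m).of_iso (Iso.refl _) e.symm⟩

end IsGorensteinProjective

/-- The snake input of a morphism of short exact sequences. -/
noncomputable def snakeInputOfShortExact {S T : ShortComplex C} (hS : S.ShortExact)
    (hT : T.ShortExact) (φ : S ⟶ T) : ShortComplex.SnakeInput C where
  L₀ := kernel φ
  L₁ := S
  L₂ := T
  L₃ := cokernel φ
  v₀₁ := kernel.ι φ
  v₁₂ := φ
  v₂₃ := cokernel.π φ
  w₀₂ := kernel.condition φ
  w₁₃ := cokernel.condition φ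
  h₀ := kernelIsKernel φ
  h₃ := cokernelIsCokernel φ
  L₁_exact := hS.exact
  epi_L₁_g := hS.epi_g
  L₂_exact := hT.exact
  mono_L₂_f := hT.mono_f

/-- The cokernels of a monomorphism of short exact sequences form a short exact sequence. -/
theorem exists_shortExact_cokernel {S T : ShortComplex C} (hS : S.ShortExact)
    (hT : T.ShortExact) (φ : S ⟶ T) [Mono φ.τ₁] [Mono φ.τ₃] :
    ∃ (R : ShortComplex C) (ψ : T ⟶ R) (w₁ : φ.τ₁ ≫ ψ.τ₁ = 0) (w₂ : φ.τ₂ ≫ ψ.τ₂ = 0)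
      (w₃ : φ.τ₃ ≫ ψ.τ₃ = 0), R.ShortExact ∧ (ShortComplex.mk _ _ w₁).ShortExact ∧
      (ShortComplex.mk _ _ w₂).ShortExact ∧ (ShortComplex.mk _ _ w₃).ShortExact := by
  let I := snakeInputOfShortExact hS hT φ
  have hz : IsZero I.L₀.X₃ := by
    rw [IsZero.iff_id_eq_zero, ← cancel_mono I.v₀₁.τ₃]
    have : Mono I.v₁₂.τ₃ := inferInstanceAs (Mono φ.τ₃)
    rw [← cancel_mono I.v₁₂.τ₃]
    simp
  have : Mono I.L₃.f := I.L₂'_exact.mono_g (hz.eq_of_src _ _)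
  have : Epi I.L₂.g := hT.epi_g
  have := hS.mono_f
  have := hT.mono_f
  have : Mono φ.τ₂ := ShortComplex.mono_τ₂_of_exact_of_mono φ hS.exact
  exact ⟨I.L₃, I.v₂₃, I.w₁₃_τ₁, I.w₁₃_τ₂, I.w₁₃_τ₃, .mk' I.L₃_exact ‹_› inferInstance,
    .mk' I.exact_C₁_down ‹_› I.epi_v₂₃_τ₁, .mk' I.exact_C₂_down ‹_› I.epi_v₂₃_τ₂,
    .mk' I.exact_C₃_down ‹_› I.epi_v₂₃_τ₃⟩

/-- The kernels of an epimorphism of short exact sequences form a short exact sequence. -/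
theorem exists_shortExact_kernel {S T : ShortComplex C} (hS : S.ShortExact)
    (hT : T.ShortExact) (φ : S ⟶ T) [Epi φ.τ₁] [Epi φ.τ₃] :
    ∃ (R : ShortComplex C) (ψ : R ⟶ S) (w₁ : ψ.τ₁ ≫ φ.τ₁ = 0) (w₂ : ψ.τ₂ ≫ φ.τ₂ = 0)
      (w₃ : ψ.τ₃ ≫ φ.τ₃ = 0), R.ShortExact ∧ (ShortComplex.mk _ _ w₁).ShortExact ∧
      (ShortComplex.mk _ _ w₂).ShortExact ∧ (ShortComplex.mk _ _ w₃).ShortExact := by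
  let I := snakeInputOfShortExact hS hT φ
  have hz : IsZero I.L₃.X₁ := by
    rw [IsZero.iff_id_eq_zero, ← cancel_epi I.v₂₃.τ₁]
    have : Epi I.v₁₂.τ₁ := inferInstanceAs (Epi φ.τ₁)
    rw [← cancel_epi I.v₁₂.τ₁]
    simp
  have : Epi I.L₀.g := I.L₁'_exact.epi_f (hz.eq_of_tgt _ _)
  have : Mono I.L₁.f := hS.mono_f
  have := hS.epi_g
  have := hT.epi_g
  have : Epi φ.τ₂ := ShortComplex.epi_τ₂_of_exact_of_epi φ hT.exact
  exact ⟨I.L₀, I.v₀₁, I.w₀₂_τ₁, I.w₀₂_τ₂, I.w₀₂_τ₃, .mk' I.L₀_exact inferInstance ‹_›,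
    .mk' I.exact_C₁_up I.mono_v₀₁_τ₁ ‹_›, .mk' I.exact_C₂_up I.mono_v₀₁_τ₂ ‹_›,
    .mk' I.exact_C₃_up I.mono_v₀₁_τ₃ ‹_›⟩

theorem biprod_shortExact (P Q : C) :
    (ShortComplex.mk (biprod.inl : P ⟶ P ⊞ Q) biprod.snd (by simp)).ShortExact :=
  (ShortComplex.Splitting.ofHasBinaryBiproduct P Q).shortExact

/-- The class of Gorenstein projective objects is closed under extensions. -/
theorem IsGorensteinProjective.of_shortExact {A B D : C} (a : A ⟶ B) (b : B ⟶ D)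
    (w : a ≫ b = 0) (hS : (ShortComplex.mk a b w).ShortExact) (hA : IsGorensteinProjective A)
    (hD : IsGorensteinProjective D) : IsGorensteinProjective B := by
  refine isGorensteinProjective_of_closed
    (fun M => ∃ S : ShortComplex C, S.ShortExact ∧ S.X₂ = M ∧ IsGorensteinProjective S.X₁ ∧
      IsGorensteinProjective S.X₃) ?_ ?_ ?_ ⟨_, hS, rfl, hA, hD⟩
  · rintro _ ⟨S, hS, rfl, h₁, h₃⟩
    exact .of_extension S.f S.g S.zero hS h₁.extendsToProjectives h₃.extendsToProjectives
  · rintro _ ⟨S, hS, rfl, h₁, h₃⟩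
    obtain ⟨A', hA', P, i, p, w, hP, hPS⟩ := h₁.exists_isSyzygy_right
    obtain ⟨D', hD', Q, j, q, w', hQ, hQS⟩ := h₃.exists_isSyzygy_right
    obtain ⟨l, hl⟩ := h₃.extendsToProjectives _ _ S.f S.g S.zero hS P hP i
    let φ : S ⟶ ShortComplex.mk (biprod.inl : P ⟶ P ⊞ Q) biprod.snd (by simp) :=
      { τ₁ := i
        τ₂ := biprod.lift l (S.g ≫ j)
        τ₃ := j
        comm₁₂ := by apply biprod.hom_ext <;> simp [hl]
        comm₂₃ := by simp }
    have : Mono φ.τ₁ := hPS.mono_f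
    have : Mono φ.τ₃ := hQS.mono_f
    obtain ⟨R, ψ, w₁, w₂, w₃, hR, e₁, e₂, e₃⟩ :=
      exists_shortExact_cokernel hS (biprod_shortExact P Q) φ
    refine ⟨R.X₂, ⟨R, hR, rfl, hA'.of_iso ?_, hD'.of_iso ?_⟩,
      P ⊞ Q, _, _, w₂, (inferInstance : Projective (P ⊞ Q)), e₂⟩
    · exact hPS.gIsCokernel.coconePointUniqueUpToIso e₁.gIsCokernel
    · exact hQS.gIsCokernel.coconePointUniqueUpToIso e₃.gIsCokernel
  · rintro _ ⟨S, hS, rfl, h₁, h₃⟩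
    obtain ⟨A', hA', P, i, p, w, hP, hPS⟩ := h₁.exists_isSyzygy_left
    obtain ⟨D', hD', Q, j, q, w', hQ, hQS⟩ := h₃.exists_isSyzygy_left
    have := hS.epi_g
    let l : Q ⟶ S.X₂ := Projective.factorThru q S.g
    let φ : ShortComplex.mk (biprod.inl : P ⟶ P ⊞ Q) biprod.snd (by simp) ⟶ S :=
      { τ₁ := p
        τ₂ := biprod.desc (p ≫ S.f) l
        τ₃ := q
        comm₁₂ := by simp
        comm₂₃ := by apply biprod.hom_ext' <;> simp [l] }
    have : Epi φ.τ₁ := hPS.epi_g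
    have : Epi φ.τ₃ := hQS.epi_g
    obtain ⟨R, ψ, w₁, w₂, w₃, hR, e₁, e₂, e₃⟩ :=
      exists_shortExact_kernel (biprod_shortExact P Q) hS φ
    refine ⟨R.X₂, ⟨R, hR, rfl, hA'.of_iso ?_, hD'.of_iso ?_⟩,
      P ⊞ Q, _, _, w₂, (inferInstance : Projective (P ⊞ Q)), e₂⟩
    · exact hPS.fIsKernel.conePointUniqueUpToIso e₁.fIsKernel
    · exact hQS.fIsKernel.conePointUniqueUpToIso e₃.fIsKernel

/-- Pushing out a morphism does not change its cokernel. -/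
noncomputable def cokernelPushoutInrIso {X Y Z : C} (f : X ⟶ Y) (g : X ⟶ Z) :
    cokernel (pushout.inr f g) ≅ cokernel f where
  hom := cokernel.desc _ (pushout.desc (cokernel.π f) 0 (by simp)) (pushout.inr_desc _ _ _)
  inv := cokernel.desc _ (pushout.inl f g ≫ cokernel.π _) (by
    rw [pushout.condition_assoc, cokernel.condition, comp_zero])
  hom_inv_id := by
    apply coequalizer.hom_ext
    apply pushout.hom_ext
    · simp [pushout.inl_desc_assoc]
    · simp [pushout.inr_desc_assoc]
  inv_hom_id := by
    apply coequalizer.hom_ext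
    simp [pushout.inl_desc]

end GorensteinExtensions

/-- part of Lemma 4.2 of the paper. Given Gorenstein projective objects
`X`, `Y`, `Z`, a monomorphism `f : X ⟶ Y` with Gorenstein projective cokernel and an
arbitrary morphism `g : X ⟶ Z`, the pushout `Y ⊔_X Z` is Gorenstein projective, and the
canonical morphism `Z ⟶ Y ⊔_X Z` is a monomorphism whose cokernel is isomorphic to the
cokernel of `f`. -/
theorem pushout_gorenstein_projective
    {C : Type*} [Category C] [Abelian C] [EnoughProjectives C]
    (X Y Z : C) (hX : IsGorensteinProjective X) (hY : IsGorensteinProjective Y)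
    (hZ : IsGorensteinProjective Z)
    (f : X ⟶ Y) (g : X ⟶ Z) [Mono f] (hcoker : IsGorensteinProjective (cokernel f)) :
    IsGorensteinProjective (pushout f g) ∧ Mono (pushout.inr f g) ∧
      Nonempty (cokernel (pushout.inr f g) ≅ cokernel f) := by
  have hinr : Mono (pushout.inr f g) := inferInstance
  refine ⟨?_, hinr, ⟨cokernelPushoutInrIso f g⟩⟩
  exact .of_shortExact (pushout.inr f g) (cokernel.π _) (cokernel.condition _)
    (.mk' (ShortComplex.cokernelSequence_exact _) hinr (by dsimp; infer_instance)) hZ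
    (hcoker.of_iso (cokernelPushoutInrIso f g).symm)
end

section
/- Let (F, H) be a Gorenstein stable Frobenius pair between finite dimensional k-algebras A and B. Then every finitely generated Gorenstein projective left A-module is projective if and only if every finitely generated Gorenstein projective left B-module is projective; that is, A is CM-free if and only if B is CM-free. -/
open CategoryTheory CategoryTheory.Limits

universe v u₁ u₂

section FGGorensteinPrelude

variable {A : Type u₁} [Ring A]

/-- A totally acyclic complex of finitely generated projective modules: each term is a
finitely generated projective module, consecutive differentials compose to zero, the
complex is acyclic, and it stays acyclic after applying `Hom(-, Q)` for every finitely
generated projective module `Q`. -/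
structure IsFGTotallyAcyclic (P : ℤ → ModuleCat.{v} A)
    (d : ∀ n : ℤ, P n ⟶ P (n + 1)) : Prop where
  finite : ∀ n, Module.Finite A (P n)
  projective : ∀ n, Projective (P n)
  comp_eq_zero : ∀ n, d n ≫ d (n + 1) = 0
  exact : ∀ n, (ShortComplex.mk (d n) (d (n + 1)) (comp_eq_zero n)).Exact
  hom_exact : ∀ (Q : ModuleCat.{v} A), Module.Finite A Q → Projective Q → ∀ n,
    Function.Exact (fun g : P (n + 1 + 1) ⟶ Q => d (n + 1) ≫ g)
      (fun g : P (n + 1) ⟶ Q => d n ≫ g)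

/-- A finitely generated module is Gorenstein projective if it is isomorphic to a cycle
of a totally acyclic complex of finitely generated projective modules. -/
def IsFGGorensteinProjective (M : ModuleCat.{v} A) : Prop :=
  Module.Finite A M ∧
    ∃ (P : ℤ → ModuleCat.{v} A) (d : ∀ n : ℤ, P n ⟶ P (n + 1))
      (_ : IsFGTotallyAcyclic P d) (n : ℤ), Nonempty (M ≅ kernel (d n))

/-- `fgPdLE n X` : `X` admits a resolution `0 → P_n → ⋯ → P_0 → X → 0` by finitely
generated projective modules. -/
def fgPdLE : ℕ → ModuleCat.{v} A → Prop
  | 0, X => Projective X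
  | (n + 1), X => ∃ (K P : ModuleCat.{v} A) (i : K ⟶ P) (p : P ⟶ X) (w : i ≫ p = 0),
      Module.Finite A P ∧ Projective P ∧ (ShortComplex.mk i p w).ShortExact ∧ fgPdLE n K

/-- `X` has finite projective dimension (within finitely generated modules). -/
def FGHasFinitePd (X : ModuleCat.{v} A) : Prop := ∃ n, fgPdLE n X

/-- `fgGpdLE n X` : `X` admits a resolution `0 → G_n → ⋯ → G_0 → X → 0` by finitely
generated Gorenstein projective modules. -/
def fgGpdLE : ℕ → ModuleCat.{v} A → Prop
  | 0, X => IsFGGorensteinProjective X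
  | (n + 1), X => ∃ (K G : ModuleCat.{v} A) (i : K ⟶ G) (p : G ⟶ X) (w : i ≫ p = 0),
      IsFGGorensteinProjective G ∧ (ShortComplex.mk i p w).ShortExact ∧ fgGpdLE n K

/-- `X` has finite Gorenstein projective dimension (within finitely generated modules). -/
def FGHasFiniteGpd (X : ModuleCat.{v} A) : Prop := ∃ n, fgGpdLE n X

/-- A morphism factors through a finitely generated projective module. -/
def FactorsThroughFGProjective {X Y : ModuleCat.{v} A} (f : X ⟶ Y) : Prop :=
  ∃ (P : ModuleCat.{v} A) (_ : Module.Finite A P) (_ : Projective P)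
    (a : X ⟶ P) (b : P ⟶ Y), f = a ≫ b

/-- `A` is CM-free: every finitely generated Gorenstein projective `A`-module is
projective. -/
def IsCMFree (A : Type u₁) [Ring A] : Prop :=
  ∀ X : ModuleCat.{v} A, IsFGGorensteinProjective X → Projective X

/-- `X` is a direct summand of `G^n` for some `n`. -/
def IsSummandOfPow (G X : ModuleCat.{v} A) : Prop :=
  ∃ (n : ℕ) (Y : ModuleCat.{v} A), Nonempty ((X ⊞ Y) ≅ ⨁ (fun _ : Fin n => G))

/-- `A` is CM-finite: there is a finitely generated Gorenstein projective `A`-module `G`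
such that every finitely generated Gorenstein projective `A`-module is a direct summand
of `G^n` for some `n`. -/
def IsCMFinite (A : Type u₁) [Ring A] : Prop :=
  ∃ G : ModuleCat.{v} A, IsFGGorensteinProjective G ∧
    ∀ X : ModuleCat.{v} A, IsFGGorensteinProjective X → IsSummandOfPow G X

end FGGorensteinPrelude

section GorensteinStableFrobenius

variable {k : Type u₁} [Field k]

/-- A Gorenstein stable Frobenius pair between two algebras `A` and `B`, encoded on the
(ambient) module categories: a Frobenius pair `(F, H)` (both `(F, H)` and `(H, F)` are
adjoint pairs) of faithful functors preserving finitely generated modules, finitely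
generated projective modules and finitely generated Gorenstein projective modules, such
that the cokernel of the unit at every finitely generated Gorenstein projective module and
the kernel of the counit at every finitely generated module of finite Gorenstein
projective dimension have finite projective dimension.  (Exactness of `F` and `H` is
automatic since each is both a left and a right adjoint.) -/
structure GorensteinStableFrobeniusPair (A : Type u₁) [Ring A] (B : Type u₂) [Ring B]
    (F : ModuleCat.{v} A ⥤ ModuleCat.{v} B) (H : ModuleCat.{v} B ⥤ ModuleCat.{v} A) where
  adj₁ : F ⊣ H
  adj₂ : H ⊣ F
  faithful_F : F.Faithful
  faithful_H : H.Faithful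
  fg_F : ∀ X : ModuleCat.{v} A, Module.Finite A X → Module.Finite B (F.obj X)
  fg_H : ∀ Y : ModuleCat.{v} B, Module.Finite B Y → Module.Finite A (H.obj Y)
  proj_F : ∀ X : ModuleCat.{v} A, Module.Finite A X → Projective X → Projective (F.obj X)
  proj_H : ∀ Y : ModuleCat.{v} B, Module.Finite B Y → Projective Y → Projective (H.obj Y)
  gp_F : ∀ X : ModuleCat.{v} A,
    IsFGGorensteinProjective X → IsFGGorensteinProjective (F.obj X)
  gp_H : ∀ Y : ModuleCat.{v} B,
    IsFGGorensteinProjective Y → IsFGGorensteinProjective (H.obj Y)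
  unit_coker : ∀ X : ModuleCat.{v} A, IsFGGorensteinProjective X →
    FGHasFinitePd (cokernel (adj₁.unit.app X))
  counit_ker : ∀ Y : ModuleCat.{v} B, Module.Finite B Y → FGHasFiniteGpd Y →
    FGHasFinitePd (kernel (adj₁.counit.app Y))

end GorensteinStableFrobenius

section HomExact

variable {A : Type u₁} [Ring A]

/-- `Hom(-, X)` preserves the exactness of every totally acyclic complex of finitely generated
projective modules. -/
def PreservesTotalAcyclicity (X : ModuleCat.{v} A) : Prop :=
  ∀ (P : ℤ → ModuleCat.{v} A) (d : ∀ n : ℤ, P n ⟶ P (n + 1)), IsFGTotallyAcyclic P d →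
    ∀ (n : ℤ) (g : P (n + 1) ⟶ X), d n ≫ g = 0 → ∃ h : P (n + 1 + 1) ⟶ X, d (n + 1) ≫ h = g

theorem PreservesTotalAcyclicity.of_projective {X : ModuleCat.{v} A} (hX : Module.Finite A X)
    (hp : Projective X) : PreservesTotalAcyclicity X := fun _ _ hP n g hg =>
  (hP.hom_exact X hX hp n g).1 hg

/-- In a short exact sequence, the property passes to the right hand term. -/
theorem PreservesTotalAcyclicity.of_left_middle {S : ShortComplex (ModuleCat.{v} A)}
    (hS : S.ShortExact) (h₁ : PreservesTotalAcyclicity S.X₁)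
    (h₂ : PreservesTotalAcyclicity S.X₂) : PreservesTotalAcyclicity S.X₃ := by
  intro P d hP n g hg
  have := hS.mono_f
  have := hS.epi_g
  have := hP.projective
  obtain ⟨m, rfl⟩ : ∃ m, n = m + 1 := ⟨n - 1, by omega⟩
  let g' := Projective.factorThru g S.g
  have hg' : g' ≫ S.g = g := Projective.factorThru_comp g S.g
  let h := hS.exact.lift (d (m + 1) ≫ g') (by rw [Category.assoc, hg', hg])
  have hh : h ≫ S.f = d (m + 1) ≫ g' := hS.exact.lift_f _ _
  obtain ⟨h', hh'⟩ := h₁ P d hP m h (by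
    rw [← cancel_mono S.f, Category.assoc, hh, ← Category.assoc, hP.comp_eq_zero]
    simp)
  obtain ⟨t, ht⟩ := h₂ P d hP (m + 1) (g' - h' ≫ S.f) (by
    rw [Preadditive.comp_sub, ← Category.assoc, hh', hh, sub_self])
  refine ⟨t ≫ S.g, ?_⟩
  rw [← Category.assoc, ht, Preadditive.sub_comp, Category.assoc, S.zero, comp_zero, sub_zero,
    hg']

/-- In a short exact sequence, the property passes to the left hand term. -/
theorem PreservesTotalAcyclicity.of_middle_right {S : ShortComplex (ModuleCat.{v} A)}
    (hS : S.ShortExact) (h₂ : PreservesTotalAcyclicity S.X₂)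
    (h₃ : PreservesTotalAcyclicity S.X₃) : PreservesTotalAcyclicity S.X₁ := by
  intro P d hP n g hg
  have := hS.mono_f
  have := hS.epi_g
  have := hP.projective
  obtain ⟨h, hh⟩ := h₂ P d hP n (g ≫ S.f) (by rw [← Category.assoc, hg, zero_comp])
  obtain ⟨u, hu⟩ := h₃ P d hP (n + 1) (h ≫ S.g) (by
    rw [← Category.assoc, hh, Category.assoc, S.zero, comp_zero])
  let u' := Projective.factorThru u S.g
  have hu' : u' ≫ S.g = u := Projective.factorThru_comp u S.g
  let w := hS.exact.lift (h - d (n + 1 + 1) ≫ u') (by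
    rw [Preadditive.sub_comp, Category.assoc, hu', hu, sub_self])
  have hw : w ≫ S.f = h - d (n + 1 + 1) ≫ u' := hS.exact.lift_f _ _
  refine ⟨w, ?_⟩
  rw [← cancel_mono S.f, Category.assoc, hw, Preadditive.comp_sub, hh, ← Category.assoc,
    hP.comp_eq_zero, zero_comp, sub_zero]

theorem PreservesTotalAcyclicity.of_finitePd [IsNoetherianRing A] {X : ModuleCat.{v} A}
    (hX : Module.Finite A X) (h : FGHasFinitePd X) : PreservesTotalAcyclicity X := by
  obtain ⟨n, hn⟩ := h
  induction n generalizing X with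
  | zero => exact .of_projective hX hn
  | succ n ih =>
    obtain ⟨K, P, i, p, w, hP, hPp, hS, hK⟩ := hn
    have hKf : Module.Finite A K :=
      Module.Finite.of_injective i.hom ((ModuleCat.mono_iff_injective i).1 hS.mono_f)
    exact .of_left_middle hS (ih hKf hK) (.of_projective hP hPp)

/-- A Gorenstein projective module `X` such that `Hom(-, X)` preserves total acyclicity is
projective, being a direct summand of a term of a totally acyclic complex. -/
theorem IsFGGorensteinProjective.projective {X : ModuleCat.{v} A}
    (hX : IsFGGorensteinProjective X) (h : PreservesTotalAcyclicity X) : Projective X := by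
  obtain ⟨-, P, d, hP, n, ⟨e⟩⟩ := hX
  obtain ⟨m, rfl⟩ : ∃ m, n = m + 1 + 1 := ⟨n - 2, by omega⟩
  have := hP.projective
  let q : P (m + 1) ⟶ kernel (d (m + 1 + 1)) :=
    kernel.lift _ (d (m + 1)) (hP.comp_eq_zero (m + 1))
  have hq : q ≫ kernel.ι (d (m + 1 + 1)) = d (m + 1) := kernel.lift_ι _ _ _
  have : Epi q := (hP.exact (m + 1)).epi_kernelLift
  obtain ⟨r, hr⟩ := h P d hP m (q ≫ e.inv) (by
    rw [← Category.assoc, Preadditive.IsIso.comp_right_eq_zero,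
      ← cancel_mono (kernel.ι (d (m + 1 + 1))), Category.assoc, hq, hP.comp_eq_zero, zero_comp])
  have hid : kernel.ι (d (m + 1 + 1)) ≫ r = e.inv := by
    rw [← cancel_epi q, ← Category.assoc, hq, hr]
  exact Retract.projective (Y := P (m + 1 + 1))
    ⟨e.hom ≫ kernel.ι (d (m + 1 + 1)), r, by rw [Category.assoc, hid, e.hom_inv_id]⟩

end HomExact

/-- Proposition 4.8(1) of the paper. Let `(F, H)` be a Gorenstein stable
Frobenius pair between finite dimensional `k`-algebras `A` and `B`. Then `A` is CM-free
if and only if `B` is CM-free, i.e. every finitely generated Gorenstein projective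
`A`-module is projective iff every finitely generated Gorenstein projective `B`-module is
projective. -/
theorem gorenstein_stable_frobenius_cm_free_iff
    {k : Type u₁} [Field k]
    {A : Type u₁} [Ring A] [Algebra k A] [FiniteDimensional k A]
    {B : Type u₂} [Ring B] [Algebra k B] [FiniteDimensional k B]
    (F : ModuleCat.{v} A ⥤ ModuleCat.{v} B) (H : ModuleCat.{v} B ⥤ ModuleCat.{v} A)
    [F.Additive] [H.Additive]
    (pair : GorensteinStableFrobeniusPair A B F H) :
    IsCMFree.{v} A ↔ IsCMFree.{v} B := by
  have : IsNoetherianRing A := .of_finite k A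
  have : IsNoetherianRing B := .of_finite k B
  have := pair.faithful_F
  have := pair.faithful_H
  constructor
  · intro hA Y hY
    have hHY := pair.gp_H Y hY
    have hfin := pair.fg_F _ hHY.1
    let ε : F.obj (H.obj Y) ⟶ Y := pair.adj₁.counit.app Y
    have : Epi ε := inferInstanceAs (Epi (pair.adj₁.counit.app Y))
    have hS : (ShortComplex.mk (kernel.ι ε) ε (kernel.condition ε)).ShortExact :=
      { exact := ShortComplex.exact_of_f_is_kernel _ (kernelIsKernel ε) }
    have hK : Module.Finite B (kernel ε : ModuleCat.{v} B) :=
      Module.Finite.of_injective (kernel.ι ε).hom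
        ((ModuleCat.mono_iff_injective _).1 inferInstance)
    exact hY.projective (.of_left_middle hS (.of_finitePd hK (pair.counit_ker Y hY.1 ⟨0, hY⟩))
      (.of_projective hfin (pair.proj_F _ hHY.1 (hA _ hHY))))
  · intro hB X hX
    have hFX := pair.gp_F X hX
    have hfin := pair.fg_H _ hFX.1
    let η : X ⟶ H.obj (F.obj X) := pair.adj₁.unit.app X
    have : Mono η := inferInstanceAs (Mono (pair.adj₁.unit.app X))
    have hS : (ShortComplex.mk η (cokernel.π η) (cokernel.condition η)).ShortExact :=
      { exact := ShortComplex.exact_of_g_is_cokernel _ (cokernelIsCokernel η) }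
    have hC : Module.Finite A (cokernel η : ModuleCat.{v} A) :=
      Module.Finite.of_surjective (cokernel.π η).hom
        ((ModuleCat.epi_iff_surjective _).1 inferInstance)
    exact hX.projective (.of_middle_right hS
      (.of_projective hfin (pair.proj_H _ hFX.1 (hB _ hFX)))
      (.of_finitePd hC (pair.unit_coker X hX)))
end

section
/- Let F : 𝒜 → 𝒝 and H : 𝒝 → 𝒜 be an adjoint pair (F, H) of additive functors between abelian categories with enough projective objects such that H is faithful and both F and H send Gorenstein projective objects to Gorenstein projective objects. If Y is a Gorenstein projective object of 𝒝 such that the kernel of the counit ε_Y : FH(Y) → Y has finite projective dimension, then ε_Y is a split epimorphism; in particular Y is a direct summand of FH(Y). -/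
open CategoryTheory CategoryTheory.Limits

section GorensteinExt

variable {C : Type*} [Category C] [Abelian C]

/-- A totally acyclic complex stays exact after applying `Hom(-, X)` for every object `X` of
finite projective dimension. -/
theorem IsTotallyAcyclic.exists_factorization_of_pdLE {P : ℤ → C}
    {d : ∀ n : ℤ, P n ⟶ P (n + 1)} (hP : IsTotallyAcyclic P d) {k : ℕ} {X : C}
    (hX : pdLE k X) (n : ℤ) (f : P (n + 1) ⟶ X) (hf : d n ≫ f = 0) :
    ∃ g : P (n + 1 + 1) ⟶ X, d (n + 1) ≫ g = f := by
  induction k generalizing X n with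
  | zero => exact (hP.hom_exact X hX n f).1 hf
  | succ k ih =>
    obtain ⟨K, Q, i, p, w, hQ, hS, hK⟩ := hX
    have hmono : Mono i := hS.mono_f
    have hepi : Epi p := hS.epi_g
    have hproj := hP.projective
    obtain ⟨m, rfl⟩ : ∃ m, n = m + 1 := ⟨n - 1, by omega⟩
    let f' : P (m + 1 + 1) ⟶ Q := Projective.factorThru f p
    have hf' : f' ≫ p = f := Projective.factorThru_comp f p
    obtain ⟨l, hl⟩ : ∃ l : P (m + 1) ⟶ K, l ≫ i = d (m + 1) ≫ f' :=
      ⟨hS.exact.lift (d (m + 1) ≫ f') (by simp [hf', hf]), hS.exact.lift_f _ _⟩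
    have hdl : d m ≫ l = 0 := by
      rw [← cancel_mono i, Category.assoc, hl, ← Category.assoc, hP.comp_eq_zero]
      simp
    obtain ⟨v, hv⟩ := ih hK m l hdl
    obtain ⟨u, hu⟩ := (hP.hom_exact Q hQ (m + 1) (f' - v ≫ i)).1 (by
      simp only [Preadditive.comp_sub]
      rw [← hl, ← hv, Category.assoc, sub_self])
    refine ⟨u ≫ p, ?_⟩
    dsimp only at hu
    rw [← Category.assoc, hu, Preadditive.sub_comp, hf', Category.assoc, w, comp_zero, sub_zero]

/-- An epimorphism onto a Gorenstein projective object splits if its kernel has finite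
projective dimension. -/
theorem IsGorensteinProjective.isSplitEpi_of_hasFinitePd_kernel {E Y : C}
    (hY : IsGorensteinProjective Y) (e : E ⟶ Y) [Epi e] (hK : HasFinitePd (kernel e)) :
    IsSplitEpi e := by
  obtain ⟨P, d, hP, n, ⟨φ⟩⟩ := hY
  obtain ⟨k, hk⟩ := hK
  have hproj := hP.projective
  obtain ⟨m, rfl⟩ : ∃ m, n = m + 1 + 1 + 1 := ⟨n - 3, by omega⟩
  let q : P (m + 1 + 1) ⟶ kernel (d (m + 1 + 1 + 1)) :=
    kernel.lift _ (d (m + 1 + 1)) (hP.comp_eq_zero _)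
  have hq : q ≫ kernel.ι _ = d (m + 1 + 1) := kernel.lift_ι _ _ _
  have hq_epi : Epi q := (hP.exact (m + 1 + 1)).epi_kernelLift
  have hdq : d (m + 1) ≫ q = 0 := by
    rw [← cancel_mono (kernel.ι _), Category.assoc, hq, hP.comp_eq_zero, zero_comp]
  have hq_exact : (ShortComplex.mk (d (m + 1)) q hdq).Exact := by
    let ψ : ShortComplex.mk (d (m + 1)) q hdq ⟶
        ShortComplex.mk (d (m + 1)) (d (m + 1 + 1)) (hP.comp_eq_zero _) :=
      { τ₁ := 𝟙 _
        τ₂ := 𝟙 _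
        τ₃ := kernel.ι _
        comm₁₂ := by simp
        comm₂₃ := by simp [hq] }
    have : Epi ψ.τ₁ := inferInstanceAs (Epi (𝟙 _))
    have : IsIso ψ.τ₂ := inferInstanceAs (IsIso (𝟙 _))
    have : Mono ψ.τ₃ := inferInstanceAs (Mono (kernel.ι _))
    exact (ShortComplex.exact_iff_of_epi_of_isIso_of_mono ψ).2 (hP.exact (m + 1))
  let g : P (m + 1 + 1) ⟶ E := Projective.factorThru (q ≫ φ.inv) e
  have hg : g ≫ e = q ≫ φ.inv := Projective.factorThru_comp _ _
  let l : P (m + 1) ⟶ kernel e := kernel.lift e (d (m + 1) ≫ g) (by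
    rw [Category.assoc, hg, ← Category.assoc, hdq, zero_comp])
  have hl : l ≫ kernel.ι e = d (m + 1) ≫ g := kernel.lift_ι _ _ _
  obtain ⟨u, hu⟩ := hP.exists_factorization_of_pdLE hk m l (by
    rw [← cancel_mono (kernel.ι e), Category.assoc, hl, ← Category.assoc, hP.comp_eq_zero]
    simp)
  obtain ⟨s, hs⟩ : ∃ s : kernel (d (m + 1 + 1 + 1)) ⟶ E, q ≫ s = g - u ≫ kernel.ι e :=
    ⟨hq_exact.desc (g - u ≫ kernel.ι e) (by
      dsimp only
      rw [Preadditive.comp_sub, ← hl, ← hu, Category.assoc, sub_self]), hq_exact.g_desc _ _⟩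
  refine IsSplitEpi.mk' ⟨φ.hom ≫ s, ?_⟩
  have hse : s ≫ e = φ.inv := by
    rw [← cancel_epi q, ← Category.assoc, hs, Preadditive.sub_comp, hg, Category.assoc,
      kernel.condition, comp_zero, sub_zero]
  rw [Category.assoc, hse, φ.hom_inv_id]

end GorensteinExt

/-- a step in the proof of Proposition 4.8 of the paper. Let `(F, H)` be an
adjoint pair of additive functors between abelian categories with enough projectives such
that `H` is faithful and both `F` and `H` preserve Gorenstein projective objects. If `Y` is
Gorenstein projective and the kernel of the counit `ε_Y : FH(Y) ⟶ Y` has finite projective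
dimension, then `ε_Y` is a split epimorphism; in particular `Y` is a direct summand of
`FH(Y)`. -/
theorem counit_split_epi_of_kernel_finite_pd
    {A : Type*} [Category A] [Abelian A] [EnoughProjectives A]
    {B : Type*} [Category B] [Abelian B] [EnoughProjectives B]
    (F : A ⥤ B) (H : B ⥤ A) [F.Additive] [H.Additive] [H.Faithful]
    (adj : F ⊣ H)
    (hFG : ∀ X : A, IsGorensteinProjective X → IsGorensteinProjective (F.obj X))
    (hHG : ∀ Y : B, IsGorensteinProjective Y → IsGorensteinProjective (H.obj Y))
    (Y : B) (hY : IsGorensteinProjective Y)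
    (hker : HasFinitePd (kernel (adj.counit.app Y))) :
    IsSplitEpi (adj.counit.app Y) ∧
      ∃ s : Y ⟶ F.obj (H.obj Y), s ≫ adj.counit.app Y = 𝟙 Y := by
  have hepi : Epi (adj.counit.app Y) := inferInstance
  have hsplit : IsSplitEpi (adj.counit.app Y) := hY.isSplitEpi_of_hasFinitePd_kernel _ hker
  exact ⟨hsplit, section_ _, IsSplitEpi.id _⟩
end

section
/- Let A and B be rings and let M be a B-A-bimodule that is finitely generated projective as a left B-module and as a right A-module, such that Hom_B(M, B) and Hom_{A^op}(M, A) are isomorphic as A-B-bimodules (i.e. M is a Frobenius bimodule), and such that M is a generator both as a left B-module and as a right A-module. Then A is Gorenstein regular (i.e. there exists n such that every left A-module has Gorenstein projective dimension at most n) if and only if B is Gorenstein regular. -/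
open CategoryTheory CategoryTheory.Limits

universe v u₁ u₂

/-- A ring is Gorenstein regular if there is a uniform bound `n` such that every left
module has Gorenstein projective dimension at most `n`. -/
def IsGorensteinRegular (A : Type u₁) [Ring A] : Prop :=
  ∃ n : ℕ, ∀ X : ModuleCat.{v} A, gpdLE n X

section ShortExactSequences

open scoped ZeroObject

variable {C : Type*} [Category C] [Abelian C]

/-- `0 → X → Y → Z → 0` is a short exact sequence. -/
def IsSES {X Y Z : C} (i : X ⟶ Y) (p : Y ⟶ Z) : Prop :=
  ∃ w : i ≫ p = 0, (ShortComplex.mk i p w).ShortExact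

namespace IsSES

variable {X Y Z : C} {i : X ⟶ Y} {p : Y ⟶ Z}

lemma zero (h : IsSES i p) : i ≫ p = 0 := h.1

lemma mono (h : IsSES i p) : Mono i := h.2.mono_f

lemma epi (h : IsSES i p) : Epi p := h.2.epi_g

lemma exists_lift (h : IsSES i p) {T : C} (t : T ⟶ Y) (ht : t ≫ p = 0) :
    ∃ t', t' ≫ i = t := by
  have := h.mono
  exact ⟨h.2.exact.lift t ht, h.2.exact.lift_f t ht⟩

lemma exists_desc (h : IsSES i p) {T : C} (t : Y ⟶ T) (ht : i ≫ t = 0) :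
    ∃ t', p ≫ t' = t := by
  have := h.epi
  exact ⟨h.2.exact.desc t ht, h.2.exact.g_desc t ht⟩

lemma mk_lift (hi : Mono i) (hp : Epi p) (w : i ≫ p = 0)
    (h : ∀ (T : C) (t : T ⟶ Y), t ≫ p = 0 → ∃ t', t' ≫ i = t) : IsSES i p := by
  refine ⟨w, ShortComplex.ShortExact.mk' (ShortComplex.exact_of_f_is_kernel _ ?_) hi hp⟩
  choose l hl using h
  exact KernelFork.IsLimit.ofι _ _ (fun t ht => l _ t ht) (fun t ht => hl _ t ht)
    (fun t ht m hm => by rw [← cancel_mono i, hm, hl])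

lemma mk_desc (hi : Mono i) (hp : Epi p) (w : i ≫ p = 0)
    (h : ∀ (T : C) (t : Y ⟶ T), i ≫ t = 0 → ∃ t', p ≫ t' = t) : IsSES i p := by
  refine ⟨w, ShortComplex.ShortExact.mk' (ShortComplex.exact_of_g_is_cokernel _ ?_) hi hp⟩
  choose l hl using h
  exact CokernelCofork.IsColimit.ofπ _ _ (fun t ht => l _ t ht) (fun t ht => hl _ t ht)
    (fun t ht m hm => by rw [← cancel_epi p, hm, hl])

lemma kernel_ι (p : Y ⟶ Z) [Epi p] : IsSES (kernel.ι p) p :=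
  mk_lift inferInstance inferInstance (by simp)
    (fun _ t ht => ⟨kernel.lift p t ht, by simp⟩)

lemma cokernel_π (i : X ⟶ Y) [Mono i] : IsSES i (cokernel.π i) :=
  mk_desc inferInstance inferInstance (by simp)
    (fun _ t ht => ⟨cokernel.desc i t ht, by simp⟩)

lemma of_iso (e : X ≅ Y) : IsSES e.hom (0 : Y ⟶ (0 : C)) :=
  mk_lift inferInstance inferInstance (by simp) (fun _ t _ => ⟨t ≫ e.inv, by simp⟩)

lemma iso_comp (h : IsSES i p) {X' : C} (e : X' ≅ X) : IsSES (e.hom ≫ i) p := by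
  have := h.mono
  refine mk_lift inferInstance h.epi (by simp [h.zero]) (fun _ t ht => ?_)
  obtain ⟨t', rfl⟩ := h.exists_lift t ht
  exact ⟨t' ≫ e.inv, by simp⟩

lemma flip (h : IsSES i p) {r : Y ⟶ X} (hr : i ≫ r = 𝟙 X) :
    ∃ s : Z ⟶ Y, IsSES s r := by
  have := h.epi
  obtain ⟨s, hs⟩ := h.exists_desc (𝟙 Y - r ≫ i) (by simp [reassoc_of% hr])
  have hsp : s ≫ p = 𝟙 Z := by
    rw [← cancel_epi p, reassoc_of% hs]; simp [h.zero]
  have hsr : s ≫ r = 0 := by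
    rw [← cancel_epi p, reassoc_of% hs]; simp [hr]
  have : IsSplitMono s := ⟨⟨⟨p, hsp⟩⟩⟩
  have : IsSplitEpi r := ⟨⟨⟨i, hr⟩⟩⟩
  refine ⟨s, mk_lift inferInstance inferInstance hsr (fun _ t ht => ⟨t ≫ p, ?_⟩)⟩
  rw [Category.assoc, hs]
  simp [reassoc_of% ht]

lemma exists_retraction (h : IsSES i p) [Projective Z] : ∃ r, i ≫ r = 𝟙 X := by
  have := h.epi
  obtain ⟨r, hr⟩ := h.exists_lift (𝟙 Y - p ≫ Projective.factorThru (𝟙 Z) p) (by simp)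
  have := h.mono
  refine ⟨r, ?_⟩
  rw [← cancel_mono i, Category.assoc, hr]
  simp [reassoc_of% h.zero]

lemma projective_mid (h : IsSES i p) (hX : Projective X) (hZ : Projective Z) :
    Projective Y := by
  obtain ⟨r, hr⟩ := h.exists_retraction
  have := h.epi
  obtain ⟨s, hs⟩ := h.exists_desc (𝟙 Y - r ≫ i) (by simp [reassoc_of% hr])
  refine ⟨fun {E W} f e _ => ⟨r ≫ Projective.factorThru (i ≫ f) e +
    p ≫ Projective.factorThru (s ≫ f) e, ?_⟩⟩
  simp [reassoc_of% hs]

lemma pushout_inr (h : IsSES i p) {X' : C} (a : X ⟶ X') :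
    IsSES (pushout.inr i a) (pushout.desc p 0 (by simp [h.zero]) : pushout i a ⟶ Z) := by
  have := h.mono
  have := h.epi
  refine mk_desc inferInstance (epi_of_epi_fac (pushout.inl_desc p 0 _))
    (pushout.inr_desc _ _ _)
    (fun T t ht => ?_)
  obtain ⟨g, hg⟩ := h.exists_desc (pushout.inl i a ≫ t) (by
    rw [pushout.condition_assoc, ht, comp_zero])
  exact ⟨g, pushout.hom_ext (by simp [pushout.inl_desc_assoc, hg])
    (by simp [pushout.inr_desc_assoc, ht])⟩

lemma pushout_inl {X' : C} {a : X ⟶ X'} {Z' : C} {q : X' ⟶ Z'} (h : IsSES a q) (i : X ⟶ Y) :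
    IsSES (pushout.inl i a) (pushout.desc 0 q (by simp [h.zero]) : pushout i a ⟶ Z') := by
  have := h.mono
  have := h.epi
  refine mk_desc inferInstance (epi_of_epi_fac (pushout.inr_desc 0 q _))
    (pushout.inl_desc _ _ _)
    (fun T t ht => ?_)
  obtain ⟨g, hg⟩ := h.exists_desc (pushout.inr i a ≫ t) (by
    rw [← pushout.condition_assoc, ht, comp_zero])
  exact ⟨g, pushout.hom_ext (by simp [pushout.inl_desc_assoc, ht])
    (by simp [pushout.inr_desc_assoc, hg])⟩

lemma pullback_snd (h : IsSES i p) {Z' : C} (a : Z' ⟶ Z) :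
    IsSES (pullback.lift i 0 (by simp [h.zero]) : X ⟶ pullback p a) (pullback.snd p a) := by
  have := h.mono
  have := h.epi
  refine mk_lift (mono_of_mono_fac (pullback.lift_fst i 0 _)) inferInstance
    (pullback.lift_snd _ _ _)
    (fun T t ht => ?_)
  obtain ⟨g, hg⟩ := h.exists_lift (t ≫ pullback.fst p a) (by
    rw [Category.assoc, pullback.condition, reassoc_of% ht, zero_comp])
  exact ⟨g, pullback.hom_ext (by simp [pullback.lift_fst, hg])
    (by simp [pullback.lift_snd, ht])⟩

lemma pullback_fst {X' Z' : C} {a : Z' ⟶ Z} {j : X' ⟶ Z'} (h : IsSES j a) (p : Y ⟶ Z) :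
    IsSES (pullback.lift 0 j (by simp [h.zero]) : X' ⟶ pullback p a) (pullback.fst p a) := by
  have := h.mono
  have := h.epi
  refine mk_lift (mono_of_mono_fac (pullback.lift_snd 0 j _)) inferInstance
    (pullback.lift_fst _ _ _)
    (fun T t ht => ?_)
  obtain ⟨g, hg⟩ := h.exists_lift (t ≫ pullback.snd p a) (by
    rw [Category.assoc, ← pullback.condition, reassoc_of% ht, zero_comp])
  exact ⟨g, pullback.hom_ext (by simp [pullback.lift_fst, ht])
    (by simp [pullback.lift_snd, hg])⟩

/-- The cokernel of a composition of two monomorphisms is an extension of their cokernels. -/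
lemma exists_mono_comp {W V : C} (h : IsSES i p) {j : Y ⟶ W} {q : W ⟶ V} (h' : IsSES j q) :
    ∃ (K : C) (c : W ⟶ K) (a : Z ⟶ K) (b : K ⟶ V), IsSES (i ≫ j) c ∧ IsSES a b := by
  have := h.mono
  have := h'.mono
  have := h.epi
  refine ⟨_, pushout.inr p j, _, _, mk_desc inferInstance inferInstance ?_ (fun T t ht => ?_),
    h'.pushout_inl p⟩
  · rw [Category.assoc, ← pushout.condition, reassoc_of% h.zero, zero_comp]
  · obtain ⟨g, hg⟩ := h.exists_desc (j ≫ t) (by simpa using ht)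
    exact ⟨pushout.desc g t hg, pushout.inr_desc _ _ _⟩

/-- The kernel of a composition of two epimorphisms is an extension of their kernels. -/
lemma exists_epi_comp {W V : C} (h : IsSES i p) {j : V ⟶ W} {q : W ⟶ Y} (h' : IsSES j q) :
    ∃ (K : C) (c : K ⟶ W) (a : V ⟶ K) (b : K ⟶ X), IsSES c (q ≫ p) ∧ IsSES a b := by
  have := h.mono
  have := h'.epi
  have := h.epi
  refine ⟨_, pullback.snd i q, _, _, mk_lift inferInstance (epi_comp _ _) ?_ (fun T t ht => ?_),
    h'.pullback_fst i⟩
  · rw [← pullback.condition_assoc, h.zero, comp_zero]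
  · obtain ⟨g, hg⟩ := h.exists_lift (t ≫ q) (by simpa using ht)
    exact ⟨pullback.lift g t hg, pullback.lift_snd _ _ _⟩

end IsSES

end ShortExactSequences

section ExtVanishing

open Abelian
open scoped ZeroObject

variable {C : Type*} [Category C] [Abelian C]

/-- All positive `Ext` groups from `X` to projective objects vanish. -/
def ProjExtVanishing (X : C) : Prop :=
  letI := HasExt.standard C
  ∀ (Q : C), Projective Q → ∀ (n : ℕ) (e : Ext X Q (n + 1)), e = 0

namespace ProjExtVanishing

variable {X Y Z : C} {i : X ⟶ Y} {p : Y ⟶ Z}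

lemma of_projective (hX : Projective X) : ProjExtVanishing X :=
  let := HasExt.standard C
  fun _ _ _ e => Ext.eq_zero_of_projective e

lemma exists_extension (h : IsSES i p) (hZ : ProjExtVanishing Z) {Q : C} (hQ : Projective Q)
    (f : X ⟶ Q) : ∃ g, i ≫ g = f := by
  let := HasExt.standard C
  obtain ⟨w, h⟩ := h
  obtain ⟨x, hx⟩ := Ext.contravariant_sequence_exact₁ h Q (Ext.mk₀ f) (add_zero 1) (hZ Q hQ 0 _)
  obtain ⟨g, rfl⟩ := (Ext.mk₀_bijective _ _).2 x
  refine ⟨g, (Ext.mk₀_bijective _ _).1 ?_⟩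
  rw [← hx, Ext.mk₀_comp_mk₀]

lemma mid (h : IsSES i p) (hX : ProjExtVanishing X) (hZ : ProjExtVanishing Z) :
    ProjExtVanishing Y := by
  let := HasExt.standard C
  obtain ⟨w, h⟩ := h
  intro Q hQ n e
  obtain ⟨x, rfl⟩ := Ext.contravariant_sequence_exact₂ h Q e (hX Q hQ n _)
  rw [hZ Q hQ n x, Ext.comp_zero]

lemma left (h : IsSES i p) (hY : ProjExtVanishing Y) (hZ : ProjExtVanishing Z) :
    ProjExtVanishing X := by
  let := HasExt.standard C
  obtain ⟨w, h⟩ := h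
  intro Q hQ n e
  obtain ⟨x, rfl⟩ := Ext.contravariant_sequence_exact₁ h Q e (by omega : 1 + (n + 1) = (n + 1) + 1)
    (hZ Q hQ (n + 1) _)
  rw [hY Q hQ n x, Ext.comp_zero]

/-- Dimension shifting along a class of objects closed under suitable syzygies. -/
lemma of_class (S : C → Prop)
    (hS : ∀ Z, S Z → ∃ (X Y : C) (i : X ⟶ Y) (p : Y ⟶ Z), IsSES i p ∧ ProjExtVanishing Y ∧ S X ∧
      ∀ (Q : C), Projective Q → ∀ f : X ⟶ Q, ∃ g, i ≫ g = f) {Z : C} (hZ : S Z) :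
    ProjExtVanishing Z := by
  let := HasExt.standard C
  intro Q hQ n
  induction n generalizing Z with
  | zero =>
    intro e
    obtain ⟨X, Y, i, p, ⟨w, h⟩, hY, -, hext⟩ := hS Z hZ
    obtain ⟨x, rfl⟩ := Ext.contravariant_sequence_exact₃ h Q e (hY Q hQ 0 _) (add_zero 1)
    obtain ⟨f, rfl⟩ := (Ext.mk₀_bijective _ _).2 x
    obtain ⟨g, rfl⟩ := hext Q hQ f
    rw [← Ext.mk₀_comp_mk₀]
    exact h.extClass_comp_assoc _
  | succ n ih =>
    intro e
    obtain ⟨X, Y, i, p, ⟨w, h⟩, hY, hX, -⟩ := hS Z hZ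
    obtain ⟨x, rfl⟩ := Ext.contravariant_sequence_exact₃ h Q e (hY Q hQ (n + 1) _)
      (by omega : 1 + (n + 1) = (n + 1) + 1)
    rw [ih hX x, Ext.comp_zero]

lemma right (h : IsSES i p) (hX : ProjExtVanishing X) (hY : ProjExtVanishing Y)
    (hext : ∀ (Q : C), Projective Q → ∀ f : X ⟶ Q, ∃ g, i ≫ g = f) :
    ProjExtVanishing Z := by
  let := HasExt.standard C
  obtain ⟨w, h⟩ := h
  intro Q hQ n e
  cases n with
  | zero =>
    obtain ⟨x, rfl⟩ := Ext.contravariant_sequence_exact₃ h Q e (hY Q hQ 0 _) (add_zero 1)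
    obtain ⟨f, rfl⟩ := (Ext.mk₀_bijective _ _).2 x
    obtain ⟨g, rfl⟩ := hext Q hQ f
    rw [← Ext.mk₀_comp_mk₀]
    exact h.extClass_comp_assoc _
  | succ n =>
    obtain ⟨x, rfl⟩ := Ext.contravariant_sequence_exact₃ h Q e (hY Q hQ (n + 1) _)
      (by omega : 1 + (n + 1) = (n + 1) + 1)
    rw [hX Q hQ n x, Ext.comp_zero]

end ProjExtVanishing

/-- `X` has a coresolution by projectives all of whose cosyzygies (including `X`) have vanishing
positive `Ext` into projectives. With enough projectives this is Gorenstein projectivity. -/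
def HasProperCoresolution (X : C) : Prop :=
  ∃ S : C → Prop, S X ∧ ∀ Y, S Y → ProjExtVanishing Y ∧
    ∃ (P Y' : C) (i : Y ⟶ P) (p : P ⟶ Y'), Projective P ∧ IsSES i p ∧ S Y'

namespace HasProperCoresolution

variable {X Y Z : C} {i : X ⟶ Y} {p : Y ⟶ Z}

lemma ext_vanishing (hX : HasProperCoresolution X) : ProjExtVanishing X := by
  obtain ⟨S, h, hS⟩ := hX
  exact (hS X h).1

lemma exists_cosyzygy (hX : HasProperCoresolution X) :
    ∃ (P Y : C) (i : X ⟶ P) (p : P ⟶ Y), Projective P ∧ IsSES i p ∧ HasProperCoresolution Y := by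
  obtain ⟨S, h, hS⟩ := hX
  obtain ⟨-, P, Y, i, p, hP, hip, hY⟩ := hS X h
  exact ⟨P, Y, i, p, hP, hip, S, hY, hS⟩

lemma of_cosyzygy (hX : ProjExtVanishing X) (hY : Projective Y) (h : IsSES i p)
    (hZ : HasProperCoresolution Z) : HasProperCoresolution X := by
  refine ⟨fun W => HasProperCoresolution W ∨ W = X, Or.inr rfl, ?_⟩
  rintro W (hW | rfl)
  · obtain ⟨P, V, j, q, hP, hjq, hV⟩ := hW.exists_cosyzygy
    exact ⟨hW.ext_vanishing, P, V, j, q, hP, hjq, Or.inl hV⟩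
  · exact ⟨hX, Y, Z, i, p, hY, h, Or.inl hZ⟩

lemma syzygy (hY : Projective Y) (h : IsSES i p) (hZ : HasProperCoresolution Z) :
    HasProperCoresolution X :=
  of_cosyzygy (.left h (.of_projective hY) hZ.ext_vanishing) hY h hZ

lemma of_projective (hX : Projective X) : HasProperCoresolution X := by
  refine ⟨Projective, hX, fun Y hY => ⟨.of_projective hY, Y, 0, _, _, hY, .of_iso (Iso.refl Y),
    inferInstance⟩⟩

lemma of_iso (hY : HasProperCoresolution Y) (e : X ≅ Y) : HasProperCoresolution X := by
  obtain ⟨P, Z, i, p, hP, h, hZ⟩ := hY.exists_cosyzygy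
  exact syzygy hP (h.iso_comp e) hZ

lemma of_extension_of_projective (hX : Projective X) (h : IsSES i p)
    (hZ : HasProperCoresolution Z) : HasProperCoresolution Y := by
  obtain ⟨r, hr⟩ := hZ.ext_vanishing.exists_extension h hX (𝟙 X)
  obtain ⟨s, hs⟩ := h.flip hr
  obtain ⟨P, W, j, q, hP, hjq, hW⟩ := hZ.exists_cosyzygy
  exact syzygy ((hs.pushout_inr j).projective_mid hP hX) (hjq.pushout_inl s) hW

lemma of_extension (hX : HasProperCoresolution X) (h : IsSES i p)
    (hZ : HasProperCoresolution Z) : HasProperCoresolution Y := by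
  refine ⟨fun W => ∃ (U V : C) (a : U ⟶ W) (b : W ⟶ V), HasProperCoresolution U ∧ IsSES a b ∧
    HasProperCoresolution V, ⟨X, Z, i, p, hX, h, hZ⟩, ?_⟩
  rintro W ⟨U, V, a, b, hU, hab, hV⟩
  refine ⟨.mid hab hU.ext_vanishing hV.ext_vanishing, ?_⟩
  obtain ⟨P, U', j, q, hP, hjq, hU'⟩ := hU.exists_cosyzygy
  obtain ⟨P', E', j', q', hP', hjq', hE'⟩ :=
    (of_extension_of_projective hP (hab.pushout_inr j) hV).exists_cosyzygy
  obtain ⟨K, c, k, l, hc, hkl⟩ := (hjq.pushout_inl a).exists_mono_comp hjq'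
  exact ⟨P', K, _, c, hP', hc, U', E', k, l, hU', hkl, hE'⟩

lemma of_kernel (hY : HasProperCoresolution Y) (h : IsSES i p)
    (hZ : HasProperCoresolution Z) : HasProperCoresolution X := by
  obtain ⟨P, Y', j, q, hP, hjq, hY'⟩ := hY.exists_cosyzygy
  obtain ⟨K, c, k, l, hc, hkl⟩ := h.exists_mono_comp hjq
  exact syzygy hP hc (of_extension hZ hkl hY')

end HasProperCoresolution

end ExtVanishing

section GorensteinProjective

variable {C : Type*} [Category C] [Abelian C]

namespace IsTotallyAcyclic

variable {P : ℤ → C} {d : ∀ n : ℤ, P n ⟶ P (n + 1)}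

lemma isSES (h : IsTotallyAcyclic P d) (n : ℤ) :
    IsSES (kernel.ι (d n)) (kernel.lift (d (n + 1)) (d n) (h.comp_eq_zero n)) := by
  have : Epi (kernel.lift (d (n + 1)) (d n) (h.comp_eq_zero n)) :=
    (h.exact n).epi_kernelLift
  refine IsSES.mk_lift inferInstance this ?_ (fun T t ht => ?_)
  · rw [← cancel_mono (kernel.ι _)]
    simp [kernel.lift_ι]
  · refine ⟨kernel.lift _ t ?_, kernel.lift_ι _ _ _⟩
    simpa [kernel.lift_ι] using ht =≫ kernel.ι (d (n + 1))

lemma exists_extension (h : IsTotallyAcyclic P d) (n : ℤ) {Q : C} (hQ : Projective Q)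
    (f : kernel (d n) ⟶ Q) : ∃ g, kernel.ι (d n) ≫ g = f := by
  obtain ⟨m, rfl⟩ : ∃ m, n = m + 1 + 1 := ⟨n - 2, by omega⟩
  have hs := h.isSES (m + 1)
  have := hs.epi
  obtain ⟨g, hg⟩ := (h.hom_exact Q hQ m
      (kernel.lift (d (m + 1 + 1)) (d (m + 1)) (h.comp_eq_zero (m + 1)) ≫ f)).1 (by
    have h0 : d m ≫ kernel.lift (d (m + 1 + 1)) (d (m + 1)) (h.comp_eq_zero (m + 1)) = 0 := by
      rw [← cancel_mono (kernel.ι _)]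
      rw [Category.assoc, kernel.lift_ι, h.comp_eq_zero, zero_comp]
    exact (reassoc_of% h0) f |>.trans zero_comp)
  refine ⟨g, ?_⟩
  rw [← cancel_epi (kernel.lift (d (m + 1 + 1)) (d (m + 1)) (h.comp_eq_zero (m + 1))), ← hg,
    kernel.lift_ι_assoc]

lemma hasProperCoresolution_kernel (h : IsTotallyAcyclic P d) (n : ℤ) :
    HasProperCoresolution (kernel (d n)) := by
  refine ⟨fun X => ∃ n, X = kernel (d n), ⟨n, rfl⟩, ?_⟩
  rintro _ ⟨n, rfl⟩
  refine ⟨.of_class (fun X => ∃ n, X = kernel (d n)) ?_ ⟨n, rfl⟩,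
    P n, _, _, _, h.projective n, h.isSES n, n + 1, rfl⟩
  rintro _ ⟨n, rfl⟩
  obtain ⟨m, rfl⟩ : ∃ m, n = m + 1 := ⟨n - 1, by omega⟩
  exact ⟨_, _, _, _, h.isSES m, .of_projective (h.projective m), ⟨m, rfl⟩,
    fun Q hQ f => h.exists_extension m hQ f⟩

end IsTotallyAcyclic

namespace IsGorensteinProjective

lemma hasProperCoresolution {X : C} (hX : IsGorensteinProjective X) :
    HasProperCoresolution X := by
  obtain ⟨P, d, h, n, ⟨e⟩⟩ := hX
  exact (h.hasProperCoresolution_kernel n).of_iso e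

lemma exists_epi {X : C} (hX : IsGorensteinProjective X) :
    ∃ (P : C) (p : P ⟶ X), Projective P ∧ Epi p := by
  obtain ⟨P, d, h, n, ⟨e⟩⟩ := hX
  obtain ⟨m, rfl⟩ : ∃ m, n = m + 1 := ⟨n - 1, by omega⟩
  have := (h.isSES m).epi
  exact ⟨P m, kernel.lift (d (m + 1)) (d m) (h.comp_eq_zero m) ≫ e.inv,
    h.projective m, epi_comp _ _⟩

end IsGorensteinProjective

/-- Splicing short exact sequences with projective middle terms. -/
lemma isGorensteinProjective_of_forall_isSES (Z : ℤ → C)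
    (hZ : ∀ n, ProjExtVanishing (Z n))
    (h : ∀ n, ∃ (P : C) (i : Z n ⟶ P) (p : P ⟶ Z (n + 1)), Projective P ∧ IsSES i p) :
    IsGorensteinProjective (Z 0) := by
  choose P i p hP h using h
  have hi := fun n => (h n).mono
  have hp := fun n => (h n).epi
  refine ⟨P, fun n => p n ≫ i (n + 1), ⟨hP, fun n => ?_, fun n => ?_, fun Q hQ n g => ⟨?_, ?_⟩⟩,
    0, ⟨?_⟩⟩
  · simp [reassoc_of% (h (n + 1)).zero]
  · rw [ShortComplex.exact_iff_exact_up_to_refinements]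
    intro A x hx
    dsimp at x hx
    obtain ⟨y, rfl⟩ := (h (n + 1)).exists_lift x (by
      rwa [← Category.assoc, ← cancel_mono (i (n + 1 + 1)), zero_comp] at *)
    exact ⟨pullback y (p n), pullback.fst _ _, inferInstance, pullback.snd _ _, by
      simp [pullback.condition_assoc]⟩
  · intro hg
    obtain ⟨t, rfl⟩ := (h (n + 1)).exists_desc g (by
      rw [← cancel_epi (p n), comp_zero]
      simpa using hg)
    obtain ⟨s, rfl⟩ := (hZ _).exists_extension (h (n + 1 + 1)) hQ t
    exact ⟨s, by simp⟩
  · rintro ⟨s, rfl⟩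
    simp [reassoc_of% (h (n + 1)).zero]
  · refine (h 0).2.fIsKernel.conePointUniqueUpToIso (kernelIsKernel _) ≪≫
      (kernelCompMono (p 0) (i (0 + 1))).symm

lemma HasProperCoresolution.isGorensteinProjective [EnoughProjectives C] {X : C}
    (hX : HasProperCoresolution X) : IsGorensteinProjective X := by
  have hr : ∀ Y : {Y : C // HasProperCoresolution Y}, ∃ (Y' : {Y : C // HasProperCoresolution Y})
      (P : C) (i : Y.1 ⟶ P) (p : P ⟶ Y'.1), Projective P ∧ IsSES i p := by
    rintro ⟨Y, hY⟩
    obtain ⟨P, Y', i, p, hP, h, hY'⟩ := hY.exists_cosyzygy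
    exact ⟨⟨Y', hY'⟩, P, i, p, hP, h⟩
  have hl : ∀ Y : {Y : C // HasProperCoresolution Y}, ∃ (Y' : {Y : C // HasProperCoresolution Y})
      (P : C) (i : Y'.1 ⟶ P) (p : P ⟶ Y.1), Projective P ∧ IsSES i p := by
    rintro ⟨Y, hY⟩
    have h := IsSES.kernel_ι (Projective.π Y)
    exact ⟨⟨_, syzygy inferInstance h hY⟩, _, _, _, inferInstance, h⟩
  choose r hr using hr
  choose l hl using hl
  let Z : ℤ → {Y : C // HasProperCoresolution Y}
    | Int.ofNat n => r^[n] ⟨X, hX⟩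
    | Int.negSucc n => l^[n + 1] ⟨X, hX⟩
  refine isGorensteinProjective_of_forall_isSES (fun n => (Z n).1)
    (fun n => (Z n).2.ext_vanishing) ?_
  rintro (n | _ | n)
  · have : Z (Int.ofNat n + 1) = r (Z (Int.ofNat n)) := Function.iterate_succ_apply' r n _
    rw [this]
    exact hr _
  · exact hl ⟨X, hX⟩
  · have : Z (Int.negSucc (n + 1)) = l (Z (Int.negSucc n)) :=
      Function.iterate_succ_apply' l (n + 1) _
    have h' : Int.negSucc (n + 1) + 1 = Int.negSucc n := by omega
    rw [this, h']
    exact hl _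

lemma isGorensteinProjective_iff [EnoughProjectives C] {X : C} :
    IsGorensteinProjective X ↔ HasProperCoresolution X :=
  ⟨fun h => h.hasProperCoresolution, fun h => h.isGorensteinProjective⟩

end GorensteinProjective

section GorensteinProjectiveDimension

variable {C : Type*} [Category C] [Abelian C]

lemma gpdLE_succ_iff {n : ℕ} {X : C} : gpdLE (n + 1) X ↔
    ∃ (K G : C) (i : K ⟶ G) (p : G ⟶ X), IsGorensteinProjective G ∧ IsSES i p ∧ gpdLE n K :=
  ⟨fun ⟨K, G, i, p, w, hG, h, hK⟩ => ⟨K, G, i, p, hG, ⟨w, h⟩, hK⟩,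
    fun ⟨K, G, i, p, hG, ⟨w, h⟩, hK⟩ => ⟨K, G, i, p, w, hG, h, hK⟩⟩

lemma enoughProjectives_of_forall_gpdLE {n : ℕ} (h : ∀ X : C, gpdLE n X) :
    EnoughProjectives C := by
  have hepi : ∀ X : C, ∃ (P : C) (p : P ⟶ X), Projective P ∧ Epi p := by
    intro X
    cases n with
    | zero => exact IsGorensteinProjective.exists_epi (h X)
    | succ n =>
      obtain ⟨K, G, i, p, hG, hip, -⟩ := gpdLE_succ_iff.1 (h X)
      obtain ⟨P, q, hP, hq⟩ := hG.exists_epi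
      have := hip.epi
      exact ⟨P, q ≫ p, hP, epi_comp _ _⟩
  refine ⟨fun X => ?_⟩
  obtain ⟨P, p, hP, hp⟩ := hepi X
  exact ⟨⟨P, p⟩⟩

variable [EnoughProjectives C] {X Y Z : C} {i : X ⟶ Y} {p : Y ⟶ Z} {n : ℕ}

lemma gpdLE_of_kernel (h : IsSES i p) (hZ : IsGorensteinProjective Z) (hY : gpdLE n Y) :
    gpdLE n X := by
  rw [isGorensteinProjective_iff] at hZ
  cases n with
  | zero =>
    exact ((isGorensteinProjective_iff.1 hY).of_kernel h hZ).isGorensteinProjective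
  | succ n =>
    obtain ⟨L, G, j, q, hG, hjq, hL⟩ := gpdLE_succ_iff.1 hY
    obtain ⟨K, c, a, b, hc, hab⟩ := h.exists_epi_comp hjq
    rw [isGorensteinProjective_iff] at hG
    exact gpdLE_succ_iff.2 ⟨L, K, a, b, (hG.of_kernel hc hZ).isGorensteinProjective, hab, hL⟩

lemma gpdLE_of_extension_of_projective (hX : Projective X) (h : IsSES i p) (hZ : gpdLE n Z) :
    gpdLE n Y := by
  cases n with
  | zero =>
    exact ((isGorensteinProjective_iff.1 hZ).of_extension_of_projective hX h).isGorensteinProjective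
  | succ n =>
    obtain ⟨L, G, j, q, hG, hjq, hL⟩ := gpdLE_succ_iff.1 hZ
    rw [isGorensteinProjective_iff] at hG
    exact gpdLE_succ_iff.2 ⟨L, _, _, _, (hG.of_extension_of_projective hX
      (h.pullback_snd q)).isGorensteinProjective, hjq.pullback_fst p, hL⟩

lemma gpdLE_syzygy (hY : Projective Y) (h : IsSES i p) (hZ : gpdLE (n + 1) Z) :
    gpdLE n X := by
  obtain ⟨L, G, j, q, hG, hjq, hL⟩ := gpdLE_succ_iff.1 hZ
  have h' := hjq.pullback_fst p
  obtain ⟨r, hr⟩ := h'.exists_retraction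
  obtain ⟨s, hs⟩ := h'.flip hr
  exact gpdLE_of_kernel (h.pullback_snd q) hG (gpdLE_of_extension_of_projective hY hs hL)

end GorensteinProjectiveDimension

section FrobeniusFunctors

variable {C D : Type*} [Category C] [Category D]
  {L : D ⥤ C} {R : C ⥤ D}

lemma projective_obj_of_adjunctions (adj₁ : L ⊣ R) (adj₂ : R ⊣ L) {P : D} (hP : Projective P) :
    Projective (L.obj P) :=
  have := Functor.preservesEpimorphisms_of_adjunction adj₂
  adj₁.map_projective P hP

lemma enoughProjectives_of_adjunctions [L.Faithful] (adj₁ : L ⊣ R) (adj₂ : R ⊣ L)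
    [EnoughProjectives C] : EnoughProjectives D := by
  have := Functor.preservesEpimorphisms_of_adjunction adj₁
  have := Functor.preservesEpimorphisms_of_adjunction adj₂
  have hP (Y : D) : Projective (R.obj (Projective.over (L.obj Y))) :=
    projective_obj_of_adjunctions adj₂ adj₁ inferInstance
  exact ⟨fun Y => ⟨{
    p := R.obj (Projective.over (L.obj Y))
    projective := hP Y
    f := R.map (Projective.π (L.obj Y)) ≫ adj₂.counit.app Y
    epi := epi_comp _ _ }⟩⟩

variable [Abelian C] [Abelian D]

lemma IsSES.map [L.Additive] (adj₁ : L ⊣ R) (adj₂ : R ⊣ L) {X Y Z : D} {i : X ⟶ Y} {p : Y ⟶ Z}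
    (h : IsSES i p) : IsSES (L.map i) (L.map p) := by
  have := h.mono
  have := h.epi
  have := Functor.preservesEpimorphisms_of_adjunction adj₁
  have := Functor.preservesMonomorphisms_of_adjunction adj₂
  have hl := adj₁.leftAdjoint_preservesColimits
  have hr := adj₂.rightAdjoint_preservesLimits
  obtain ⟨w, h⟩ := h
  exact ⟨_, h.map_of_exact L⟩

variable [L.Additive] [L.Faithful]

lemma ProjExtVanishing.of_map [EnoughProjectives D] (adj₁ : L ⊣ R) (adj₂ : R ⊣ L) {Y : D}
    (hY : ProjExtVanishing (L.obj Y)) :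
    ProjExtVanishing Y := by
  refine .of_class (fun Y => ProjExtVanishing (L.obj Y)) (fun Z hZ => ?_) hY
  have h := IsSES.kernel_ι (Projective.π Z)
  have hL := h.map adj₁ adj₂
  refine ⟨_, _, _, _, h, .of_projective inferInstance,
    .left hL (.of_projective (projective_obj_of_adjunctions adj₁ adj₂ inferInstance)) hZ,
    fun Q hQ f => ?_⟩
  obtain ⟨s, hs⟩ : ∃ s, s ≫ adj₂.counit.app Q = 𝟙 Q :=
    ⟨_, Projective.factorThru_comp (𝟙 Q) (adj₂.counit.app Q)⟩
  obtain ⟨g, hg⟩ := hZ.exists_extension hL (projective_obj_of_adjunctions adj₁ adj₂ hQ)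
    ((adj₁.homEquiv _ _).symm (f ≫ s))
  refine ⟨adj₁.homEquiv _ _ g ≫ adj₂.counit.app Q, ?_⟩
  rw [← Category.assoc, ← adj₁.homEquiv_naturality_left, hg, Equiv.apply_symm_apply,
    Category.assoc, hs]
  exact Category.comp_id f

lemma HasProperCoresolution.of_map [EnoughProjectives D] (adj₁ : L ⊣ R) (adj₂ : R ⊣ L) {Y : D}
    (hY : HasProperCoresolution (L.obj Y)) : HasProperCoresolution Y := by
  refine ⟨fun Y => HasProperCoresolution (L.obj Y), hY, fun Y hY => ⟨.of_map adj₁ adj₂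
    hY.ext_vanishing, ?_⟩⟩
  obtain ⟨Q, Z, i, p, hQ, hip, hZ⟩ := hY.exists_cosyzygy
  have := hip.mono
  have hRQ : Projective (R.obj Q) := projective_obj_of_adjunctions adj₂ adj₁ hQ
  have hLRQ : Projective (L.obj (R.obj Q)) := projective_obj_of_adjunctions adj₁ adj₂ hRQ
  let j : Y ⟶ R.obj Q := adj₁.homEquiv _ _ i
  have hj : L.map j ≫ adj₁.counit.app Q = i :=
    (adj₁.homEquiv_counit _ _ _).symm.trans (Equiv.symm_apply_apply _ _)
  have : Mono (L.map j) := mono_of_mono_fac hj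
  have : Mono j := L.mono_of_mono_map this
  have h := IsSES.cokernel_π j
  have hL := h.map adj₁ adj₂
  have hW : ProjExtVanishing (L.obj (cokernel j)) :=
    .right hL hY.ext_vanishing (.of_projective hLRQ) (fun Q' hQ' f => by
      obtain ⟨g, rfl⟩ := hZ.ext_vanishing.exists_extension hip hQ' f
      exact ⟨adj₁.counit.app Q ≫ g, by rw [reassoc_of% hj]⟩)
  have hE := of_extension_of_projective hLRQ (hip.pushout_inl (L.map j)) hZ
  obtain ⟨s, hs⟩ := (hL.pushout_inr i).flip (r := pushout.desc (adj₁.counit.app Q) (𝟙 Q)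
    (by rw [hj]; exact (Category.comp_id i).symm)) (pushout.inr_desc _ _ _)
  exact ⟨R.obj Q, _, j, _, hRQ, h, hE.of_kernel hs (.of_projective hQ)⟩

lemma gpdLE_of_map [EnoughProjectives C] [EnoughProjectives D] (adj₁ : L ⊣ R) (adj₂ : R ⊣ L)
    {n : ℕ} {Y : D} (hY : gpdLE n (L.obj Y)) : gpdLE n Y := by
  induction n generalizing Y with
  | zero =>
    exact ((isGorensteinProjective_iff.1 hY).of_map adj₁ adj₂).isGorensteinProjective
  | succ n ih =>
    have h := IsSES.kernel_ι (Projective.π Y)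
    exact gpdLE_succ_iff.2 ⟨_, _, _, _,
      (HasProperCoresolution.of_projective inferInstance).isGorensteinProjective, h,
      ih (gpdLE_syzygy (projective_obj_of_adjunctions adj₁ adj₂ inferInstance)
        (h.map adj₁ adj₂) hY)⟩

lemma forall_gpdLE_of_adjunctions (adj₁ : L ⊣ R) (adj₂ : R ⊣ L) {n : ℕ}
    (h : ∀ X : C, gpdLE n X) (Y : D) : gpdLE n Y :=
  have := enoughProjectives_of_forall_gpdLE h
  have := enoughProjectives_of_adjunctions adj₁ adj₂
  gpdLE_of_map adj₁ adj₂ (h (L.obj Y))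

end FrobeniusFunctors

/-- Lemma 5.1(2) of the paper. Let `M` be a Frobenius `B`-`A`-bimodule
which is a generator as a left `B`-module and as a right `A`-module. Since Mathlib has no
tensor product over noncommutative rings, we encode the bimodule `M` by its tensor functor
`F = M ⊗_A -` together with the common two-sided adjoint `H = N ⊗_B -` (by Morita's
theorem on strongly adjoint pairs, Frobenius pairs of additive functors between module
categories correspond exactly to Frobenius bimodules), and the generator conditions on the
two sides by the equivalent conditions that the tensor functors `F` and `H` are faithful.
The conclusion: `A` is Gorenstein regular iff `B` is Gorenstein regular. -/
theorem frobenius_bimodule_gorenstein_regular_iff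
    {A : Type u₁} [Ring A] {B : Type u₂} [Ring B]
    (F : ModuleCat.{v} A ⥤ ModuleCat.{v} B) (H : ModuleCat.{v} B ⥤ ModuleCat.{v} A)
    [F.Additive] [H.Additive] [F.Faithful] [H.Faithful]
    (adj₁ : F ⊣ H) (adj₂ : H ⊣ F) :
    IsGorensteinRegular.{v, u₁} A ↔ IsGorensteinRegular.{v, u₂} B := by
  exact ⟨fun ⟨n, hn⟩ => ⟨n, forall_gpdLE_of_adjunctions adj₂ adj₁ hn⟩,
    fun ⟨n, hn⟩ => ⟨n, forall_gpdLE_of_adjunctions adj₁ adj₂ hn⟩⟩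
end

section
/- Suppose bimodules _B M _A and _A N _B define a stable equivalence of Morita type of adjoint type between finite dimensional k-algebras A and B. Then every finitely generated Gorenstein projective A-module is projective if and only if every finitely generated Gorenstein projective B-module is projective; that is, A is CM-free if and only if B is CM-free. -/
open CategoryTheory CategoryTheory.Limits

universe v u₁ u₂

section MoritaType

open CategoryTheory CategoryTheory.Limits

/-- The pointwise biproduct of two functors into a category with binary biproducts. -/
noncomputable def biprodFunctor {C : Type*} [Category C] {D : Type*} [Category D]
    [Preadditive D] [HasBinaryBiproducts D] (S T : C ⥤ D) : C ⥤ D where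
  obj X := S.obj X ⊞ T.obj X
  map f := biprod.map (S.map f) (T.map f)
  map_id X := by ext <;> simp
  map_comp f g := by ext <;> simp

/-- Bimodules `_B M _A` and `_A N _B` defining a stable equivalence of Morita type of
adjoint type between `A` and `B`, encoded via their tensor functors `F = M ⊗_A -` and
`H = N ⊗_B -` (Mathlib has no tensor product of bimodules over noncommutative rings).
The requirements are: `(F, H)` and `(H, F)` are adjoint pairs (adjoint type); the
composite `H ∘ F` is naturally isomorphic to `𝟭 ⊕ T_P`, where `T_P = P ⊗_A -` takes only
projective values (because the bimodule `P` is projective) and preserves finitely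
generated modules, and symmetrically `F ∘ H ≅ 𝟭 ⊕ T_Q`; moreover `F` and `H` preserve
finitely generated modules.  (Exactness of `F` and `H`, i.e. projectivity of `M` and `N`
as one-sided modules, is automatic since each functor is both a left and a right
adjoint.) -/
structure StableEquivMoritaAdjointType (A : Type u₁) [Ring A] (B : Type u₂) [Ring B]
    (F : ModuleCat.{v} A ⥤ ModuleCat.{v} B) (H : ModuleCat.{v} B ⥤ ModuleCat.{v} A) where
  adj₁ : F ⊣ H
  adj₂ : H ⊣ F
  TP : ModuleCat.{v} A ⥤ ModuleCat.{v} A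
  TQ : ModuleCat.{v} B ⥤ ModuleCat.{v} B
  TP_projective : ∀ X : ModuleCat.{v} A, Projective (TP.obj X)
  TQ_projective : ∀ Y : ModuleCat.{v} B, Projective (TQ.obj Y)
  TP_fg : ∀ X : ModuleCat.{v} A, Module.Finite A X → Module.Finite A (TP.obj X)
  TQ_fg : ∀ Y : ModuleCat.{v} B, Module.Finite B Y → Module.Finite B (TQ.obj Y)
  iso₁ : F ⋙ H ≅ biprodFunctor (𝟭 (ModuleCat.{v} A)) TP
  iso₂ : H ⋙ F ≅ biprodFunctor (𝟭 (ModuleCat.{v} B)) TQ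
  fg_F : ∀ X : ModuleCat.{v} A, Module.Finite A X → Module.Finite B (F.obj X)
  fg_H : ∀ Y : ModuleCat.{v} B, Module.Finite B Y → Module.Finite A (H.obj Y)

end MoritaType

section FrobeniusPair

variable {A : Type u₁} [Ring A] {B : Type u₂} [Ring B]
  {F : ModuleCat.{v} A ⥤ ModuleCat.{v} B} {H : ModuleCat.{v} B ⥤ ModuleCat.{v} A}

/-- The left adjoint of a Frobenius pair of functors preserving finitely generated modules
preserves totally acyclic complexes of finitely generated projective modules. -/
theorem IsFGTotallyAcyclic.map [F.Additive] (adj₁ : F ⊣ H) (adj₂ : H ⊣ F)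
    (fg_F : ∀ X : ModuleCat.{v} A, Module.Finite A X → Module.Finite B (F.obj X))
    (fg_H : ∀ Y : ModuleCat.{v} B, Module.Finite B Y → Module.Finite A (H.obj Y))
    {P : ℤ → ModuleCat.{v} A} {d : ∀ n : ℤ, P n ⟶ P (n + 1)}
    (hP : IsFGTotallyAcyclic P d) :
    IsFGTotallyAcyclic (fun n => F.obj (P n)) (fun n => F.map (d n)) := by
  have := adj₁.leftAdjoint_preservesColimits
  have := adj₂.leftAdjoint_preservesColimits
  have := adj₂.rightAdjoint_preservesLimits
  refine ⟨fun n => fg_F _ (hP.finite n), fun n => adj₁.map_projective _ (hP.projective n),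
    fun n => by rw [← F.map_comp, hP.comp_eq_zero, F.map_zero],
    fun n => (hP.exact n).map F, fun Q hQ hQ' n g => ?_⟩
  have hex := hP.hom_exact (H.obj Q) (fg_H Q hQ) (adj₂.map_projective Q hQ') n
    (adj₁.homEquiv _ _ g)
  constructor
  · intro hg
    obtain ⟨f, hf⟩ := hex.1 (by
      change d n ≫ adj₁.homEquiv _ _ g = 0
      rw [← adj₁.homEquiv_naturality_left]
      change F.map (d n) ≫ g = 0 at hg
      rw [hg, Adjunction.homEquiv_unit, H.map_zero, comp_zero])
    refine ⟨(adj₁.homEquiv _ _).symm f, (adj₁.homEquiv _ _).injective ?_⟩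
    change adj₁.homEquiv _ _ (F.map (d (n + 1)) ≫ (adj₁.homEquiv _ _).symm f) = _
    rw [adj₁.homEquiv_naturality_left, Equiv.apply_symm_apply]
    exact hf
  · rintro ⟨f, rfl⟩
    change F.map (d n) ≫ F.map (d (n + 1)) ≫ f = 0
    rw [← Category.assoc, ← F.map_comp, hP.comp_eq_zero, F.map_zero, zero_comp]

/-- The left adjoint of a Frobenius pair of functors preserving finitely generated modules
preserves finitely generated Gorenstein projective modules. -/
theorem IsFGGorensteinProjective.map [F.Additive] (adj₁ : F ⊣ H) (adj₂ : H ⊣ F)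
    (fg_F : ∀ X : ModuleCat.{v} A, Module.Finite A X → Module.Finite B (F.obj X))
    (fg_H : ∀ Y : ModuleCat.{v} B, Module.Finite B Y → Module.Finite A (H.obj Y))
    {X : ModuleCat.{v} A} (hX : IsFGGorensteinProjective X) :
    IsFGGorensteinProjective (F.obj X) := by
  obtain ⟨hfin, P, d, hP, n, ⟨e⟩⟩ := hX
  have := adj₂.rightAdjoint_preservesLimits
  exact ⟨fg_F X hfin, _, _, hP.map adj₁ adj₂ fg_F fg_H, n,
    ⟨F.mapIso e ≪≫ PreservesKernel.iso F (d n)⟩⟩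

/-- CM-freeness descends along a Frobenius pair `(F, H)` of functors preserving finitely
generated modules such that every module `X` is a direct summand of `H (F X)`. -/
theorem IsCMFree.of_frobeniusPair [F.Additive] (adj₁ : F ⊣ H) (adj₂ : H ⊣ F)
    (fg_F : ∀ X : ModuleCat.{v} A, Module.Finite A X → Module.Finite B (F.obj X))
    (fg_H : ∀ Y : ModuleCat.{v} B, Module.Finite B Y → Module.Finite A (H.obj Y))
    (T : ModuleCat.{v} A ⥤ ModuleCat.{v} A) (e : F ⋙ H ≅ biprodFunctor (𝟭 _) T)
    (hB : IsCMFree.{v} B) : IsCMFree.{v} A := by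
  intro X hX
  have hFX := hB _ (hX.map adj₁ adj₂ fg_F fg_H)
  have := adj₁.leftAdjoint_preservesColimits
  have hHFX : Projective (H.obj (F.obj X)) := adj₂.map_projective _ hFX
  have hsum : Projective (X ⊞ T.obj X) := Projective.of_iso (e.app X) hHFX
  exact (⟨biprod.inl, biprod.fst, biprod.inl_fst⟩ : Retract X (X ⊞ T.obj X)).projective

end FrobeniusPair

/-- part of Corollary 5.7 of the paper. Suppose bimodules `_B M _A` and
`_A N _B` define a stable equivalence of Morita type of adjoint type between finite
dimensional `k`-algebras `A` and `B`, encoded via the tensor functors `F = M ⊗_A -` and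
`H = N ⊗_B -`. Then `A` is CM-free if and only if `B` is CM-free. -/
theorem morita_adjoint_type_cm_free_iff
    {k : Type u₁} [Field k]
    {A : Type u₁} [Ring A] [Algebra k A] [FiniteDimensional k A]
    {B : Type u₂} [Ring B] [Algebra k B] [FiniteDimensional k B]
    (F : ModuleCat.{v} A ⥤ ModuleCat.{v} B) (H : ModuleCat.{v} B ⥤ ModuleCat.{v} A)
    [F.Additive] [H.Additive]
    (sem : StableEquivMoritaAdjointType A B F H) :
    IsCMFree.{v} A ↔ IsCMFree.{v} B := by
  exact ⟨fun hA => hA.of_frobeniusPair sem.adj₂ sem.adj₁ sem.fg_H sem.fg_F sem.TQ sem.iso₂,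
    fun hB => hB.of_frobeniusPair sem.adj₁ sem.adj₂ sem.fg_F sem.fg_H sem.TP sem.iso₁⟩
end
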